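/- arXiv:1906.06647 — 3 statements merged into one kernel-verified Lean document; each statement's English description precedes it below -/
import Mathlib

section
/- Let F be a norm on ℝ^n arising from a Minkowski norm, let 1 < p < n, and let Ω ⊆ ℝ^n be an open set. Writing r(x) = F(x) and F* for the dual norm, one has ((n-p)/p)^p ∫_Ω |u(x)|^p / r(x)^p dx ≤ ∫_Ω F*(du_x)^p dx for every u ∈ C_c^∞(Ω). -/
open MeasureTheory
open Set
open scoped ENNReal

/-- The total mass of the weight `t ^ (-a)` on `(1, ∞)`. -/
lemma setLIntegral_Ioi_one_rpow_neg {a : ℝ} (ha : 1 < a) :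
    ∫⁻ t in Ioi (1 : ℝ), ENNReal.ofReal (t ^ (-a)) = ENNReal.ofReal (1 / (a - 1)) := by
  rw [← ofReal_integral_eq_lintegral_ofReal
    (integrableOn_Ioi_rpow_of_lt (by linarith) one_pos)
    (ae_restrict_of_forall_mem measurableSet_Ioi fun t ht ↦
      Real.rpow_nonneg (zero_le_one.trans (le_of_lt ht)) _),
    integral_Ioi_rpow_of_lt (by linarith) one_pos, Real.one_rpow]
  congr 1
  rw [show a - 1 = -(-a + 1) by ring, div_neg, neg_div]

/-- Hölder's inequality on `(1, ∞)` with the power weight `t ^ (-a)`. -/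
lemma rpow_setLIntegral_Ioi_one_le {a p : ℝ} (ha : 1 < a) (hp : 1 < p)
    {h : ℝ → ℝ≥0∞} (hh : Measurable h) :
    (∫⁻ t in Ioi (1 : ℝ), h t) ^ p ≤ ENNReal.ofReal (1 / (a - 1)) ^ (p - 1) *
      ∫⁻ t in Ioi (1 : ℝ), h t ^ p * ENNReal.ofReal (t ^ (a * (p - 1))) := by
  have hp0 : 0 < p := by linarith
  have hpq := Real.HolderConjugate.conjExponent hp
  set q := p.conjExponent with hq
  have hq0 : 0 < q := hpq.symm.pos
  have hpq' : p / q = p - 1 := hpq.div_conj_eq_sub_one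
  have w_meas (b : ℝ) : Measurable fun t : ℝ ↦ ENNReal.ofReal (t ^ b) := by fun_prop
  have key := ENNReal.lintegral_mul_le_Lp_mul_Lq (volume.restrict (Ioi (1 : ℝ))) hpq
    (f := fun t ↦ h t * ENNReal.ofReal (t ^ (a / q))) (g := fun t ↦ ENNReal.ofReal (t ^ (-(a / q))))
    (hh.mul (w_meas _)).aemeasurable (w_meas _).aemeasurable
  have e1 : ∫⁻ t in Ioi (1 : ℝ), h t = ∫⁻ t in Ioi (1 : ℝ),
      ((fun t ↦ h t * ENNReal.ofReal (t ^ (a / q))) *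
        (fun t ↦ ENNReal.ofReal (t ^ (-(a / q))))) t := by
    refine setLIntegral_congr_fun measurableSet_Ioi fun t ht ↦ ?_
    have ht0 : 0 < t := one_pos.trans ht
    simp only [Pi.mul_apply]
    rw [mul_assoc, ← ENNReal.ofReal_mul (by positivity), ← Real.rpow_add ht0]
    simp
  have e2 : ∫⁻ t in Ioi (1 : ℝ), (h t * ENNReal.ofReal (t ^ (a / q))) ^ p =
      ∫⁻ t in Ioi (1 : ℝ), h t ^ p * ENNReal.ofReal (t ^ (a * (p - 1))) := by
    refine setLIntegral_congr_fun measurableSet_Ioi fun t ht ↦ ?_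
    have ht0 : 0 < t := one_pos.trans ht
    rw [ENNReal.mul_rpow_of_nonneg _ _ hp0.le, ENNReal.ofReal_rpow_of_nonneg (by positivity) hp0.le,
      ← Real.rpow_mul ht0.le, ← hpq']
    ring_nf
  have e3 : ∫⁻ t in Ioi (1 : ℝ), ENNReal.ofReal (t ^ (-(a / q))) ^ q =
      ENNReal.ofReal (1 / (a - 1)) := by
    rw [← setLIntegral_Ioi_one_rpow_neg ha]
    refine setLIntegral_congr_fun measurableSet_Ioi fun t ht ↦ ?_
    have ht0 : 0 < t := one_pos.trans ht
    rw [ENNReal.ofReal_rpow_of_nonneg (by positivity) hq0.le, ← Real.rpow_mul ht0.le, neg_mul,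
      div_mul_cancel₀ _ hq0.ne']
  rw [← e1, e2, e3] at key
  refine (ENNReal.rpow_le_rpow key hp0.le).trans_eq ?_
  rw [ENNReal.mul_rpow_of_nonneg _ _ hp0.le, ← ENNReal.rpow_mul, ← ENNReal.rpow_mul,
    one_div_mul_cancel hp0.ne', ENNReal.rpow_one, mul_comm, ← hpq', one_div_mul_eq_div]

section Radial

variable {E : Type*} [NormedAddCommGroup E] [NormedSpace ℝ E] [FiniteDimensional ℝ E]
  [MeasurableSpace E] [BorelSpace E] (μ : Measure E) [μ.IsAddHaarMeasure]

/-- Change of variables for a dilation. -/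
lemma lintegral_comp_pos_smul {g : E → ℝ≥0∞} (hg : Measurable g) {t : ℝ} (ht : 0 < t) :
    ∫⁻ x, g (t • x) ∂μ =
      ENNReal.ofReal (t ^ (-(Module.finrank ℝ E : ℝ))) * ∫⁻ x, g x ∂μ := by
  rw [← lintegral_map hg (measurable_const_smul t), Measure.map_addHaar_smul μ ht.ne',
    lintegral_smul_measure, abs_of_pos (by positivity), Real.rpow_neg ht.le, Real.rpow_natCast,
    smul_eq_mul]

/-- The radial Hardy inequality: a Minkowski integral inequality for the dilations of `g`. -/
lemma lintegral_rpow_radial_le {p : ℝ} (hp : 1 < p) (hpn : p < Module.finrank ℝ E)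
    {g : E → ℝ≥0∞} (hg : Measurable g) :
    ∫⁻ x, (∫⁻ t in Ioi (1 : ℝ), g (t • x)) ^ p ∂μ ≤
      ENNReal.ofReal (p / (Module.finrank ℝ E - p)) ^ p * ∫⁻ x, g x ^ p ∂μ := by
  set n : ℝ := (Module.finrank ℝ E : ℝ) with hn
  have hp0 : 0 < p := by linarith
  have ha : 1 < n / p := (one_lt_div hp0).2 hpn
  have hC : 1 / (n / p - 1) = p / (n - p) := by field_simp
  have hsmul : Measurable fun z : E × ℝ ↦ z.2 • z.1 := by fun_prop
  have hG : Measurable fun z : E × ℝ ↦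
      g (z.2 • z.1) ^ p * ENNReal.ofReal (z.2 ^ (n / p * (p - 1))) := by
    have := hg.comp hsmul
    simp only [Function.comp_def] at this
    fun_prop
  calc ∫⁻ x, (∫⁻ t in Ioi (1 : ℝ), g (t • x)) ^ p ∂μ
    _ ≤ ∫⁻ x, ENNReal.ofReal (p / (n - p)) ^ (p - 1) * (∫⁻ t in Ioi (1 : ℝ),
          g (t • x) ^ p * ENNReal.ofReal (t ^ (n / p * (p - 1)))) ∂μ := by
        refine lintegral_mono fun x ↦ ?_
        rw [← hC]
        exact rpow_setLIntegral_Ioi_one_le ha hp (hg.comp (by fun_prop))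
    _ = ENNReal.ofReal (p / (n - p)) ^ (p - 1) * ∫⁻ t in Ioi (1 : ℝ),
          (∫⁻ x, g (t • x) ^ p * ENNReal.ofReal (t ^ (n / p * (p - 1))) ∂μ) := by
        rw [lintegral_const_mul _ hG.lintegral_prod_right', lintegral_lintegral_swap hG.aemeasurable]
    _ = ENNReal.ofReal (p / (n - p)) ^ (p - 1) * ∫⁻ t in Ioi (1 : ℝ),
          ENNReal.ofReal (t ^ (-(n / p))) * ∫⁻ x, g x ^ p ∂μ := by
        congr 1
        refine setLIntegral_congr_fun measurableSet_Ioi fun t ht ↦ ?_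
        have ht0 : 0 < t := one_pos.trans ht
        have hgt : Measurable fun x ↦ g (t • x) := hg.comp (measurable_const_smul t)
        rw [lintegral_mul_const _ (hgt.pow_const p),
          lintegral_comp_pos_smul μ (hg.pow_const p) ht0, mul_right_comm,
          ← ENNReal.ofReal_mul (by positivity), ← Real.rpow_add ht0]
        congr 3
        rw [← hn]
        field_simp
        ring
    _ = ENNReal.ofReal (p / (n - p)) ^ p * ∫⁻ x, g x ^ p ∂μ := by
        rw [lintegral_mul_const _ (by fun_prop), setLIntegral_Ioi_one_rpow_neg ha, hC, ← mul_assoc]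
        congr 1
        have hpos : 0 < p / (n - p) := div_pos hp0 (sub_pos.2 hpn)
        nth_rewrite 2 [← ENNReal.rpow_one (ENNReal.ofReal (p / (n - p)))]
        rw [← ENNReal.rpow_add _ _ (by simpa using hpos) ENNReal.ofReal_ne_top, sub_add_cancel]

end Radial

/-- A compactly supported `C¹` function is controlled by the integral of its radial derivative
along the ray from `x` to infinity. -/
lemma enorm_le_setLIntegral_radial_fderiv {E : Type*} [NormedAddCommGroup E] [NormedSpace ℝ E]
    {u : E → ℝ} (hu : ContDiff ℝ 1 u) (hc : HasCompactSupport u) {x : E} (hx : x ≠ 0) :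
    ‖u x‖ₑ ≤ ∫⁻ t in Ioi (1 : ℝ), ‖fderiv ℝ u (t • x) x‖ₑ := by
  obtain ⟨R, hR⟩ := hc.isCompact.isBounded.exists_norm_le
  set T : ℝ := max 1 ((R + 1) / ‖x‖) with hT
  have hx' : 0 < ‖x‖ := norm_pos_iff.2 hx
  have hT1 : 1 ≤ T := le_max_left _ _
  have huT : u (T • x) = 0 := by
    by_contra h
    have h1 := hR _ (subset_tsupport u h)
    have h2 : (R + 1) / ‖x‖ ≤ T := le_max_right _ _
    rw [norm_smul, Real.norm_of_nonneg (by linarith)] at h1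
    rw [div_le_iff₀ hx'] at h2
    linarith
  have hderiv (t : ℝ) : HasDerivAt (fun t : ℝ ↦ u (t • x)) (fderiv ℝ u (t • x) x) t := by
    have h := ((hu.differentiable one_ne_zero) (t • x)).hasFDerivAt.comp_hasDerivAt t
      ((hasDerivAt_id t).smul_const x)
    simpa [Function.comp_def] using h
  have hcont : Continuous fun t : ℝ ↦ fderiv ℝ u (t • x) x :=
    ((hu.continuous_fderiv one_ne_zero).comp (by fun_prop)).clm_apply continuous_const
  have hFTC := intervalIntegral.integral_eq_sub_of_hasDerivAt (fun t _ ↦ hderiv t)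
    (hcont.intervalIntegrable 1 T)
  rw [huT, one_smul, zero_sub, intervalIntegral.integral_of_le hT1] at hFTC
  calc ‖u x‖ₑ = ‖∫ t in Ioc 1 T, fderiv ℝ u (t • x) x‖ₑ := by rw [hFTC, enorm_neg]
    _ ≤ ∫⁻ t in Ioc 1 T, ‖fderiv ℝ u (t • x) x‖ₑ := enorm_integral_le_lintegral_enorm _
    _ ≤ ∫⁻ t in Ioi (1 : ℝ), ‖fderiv ℝ u (t • x) x‖ₑ := lintegral_mono_set Ioc_subset_Ioi_self

section DualNorm

variable {E : Type*} [NormedAddCommGroup E] [NormedSpace ℝ E]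

/-- An absolutely homogeneous function that is continuous and positive away from the origin
dominates a multiple of the norm. -/
lemma exists_pos_mul_norm_le_of_homogeneous [FiniteDimensional ℝ E] {F : E → ℝ}
    (hF_pos : ∀ y, y ≠ 0 → 0 < F y) (hF_homog : ∀ (c : ℝ) y, F (c • y) = |c| * F y)
    (hF_cont : ContinuousOn F {y | y ≠ 0}) : ∃ c > 0, ∀ y, c * ‖y‖ ≤ F y := by
  have hF0 : F 0 = 0 := by simpa using hF_homog 0 0
  rcases subsingleton_or_nontrivial E with _ | _
  · refine ⟨1, one_pos, fun y ↦ ?_⟩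
    simp [Subsingleton.elim y 0, hF0]
  have hsub : Metric.sphere (0 : E) 1 ⊆ {y | y ≠ 0} := fun y hy ↦ ne_zero_of_mem_unit_sphere ⟨y, hy⟩
  obtain ⟨y₀, hy₀, hmin⟩ := (isCompact_sphere (0 : E) 1).exists_isMinOn
    (NormedSpace.sphere_nonempty.2 zero_le_one) (hF_cont.mono hsub)
  refine ⟨F y₀, hF_pos _ (hsub hy₀), fun y ↦ ?_⟩
  rcases eq_or_ne y 0 with rfl | hy
  · simp [hF0]
  have hy' : 0 < ‖y‖ := norm_pos_iff.2 hy
  have h : F y₀ ≤ F (‖y‖⁻¹ • y) := hmin (by simp [norm_smul, hy'.ne'])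
  rw [hF_homog, abs_of_pos (inv_pos.2 hy'), inv_mul_eq_div] at h
  exact (le_div_iff₀ hy').1 h

/-- The dual of a gauge `F`. -/
noncomputable def dualGauge (F : E → ℝ) (ξ : E →L[ℝ] ℝ) : ℝ :=
  ⨆ y : {y : E // y ≠ 0}, ξ (y : E) / F (y : E)

variable {F : E → ℝ} {c : ℝ}

lemma div_le_opNorm_div (hc : 0 < c) (hF : ∀ y, c * ‖y‖ ≤ F y) (ξ : E →L[ℝ] ℝ) {y : E}
    (hy : y ≠ 0) : ξ y / F y ≤ ‖ξ‖ / c := by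
  have hy' : 0 < ‖y‖ := norm_pos_iff.2 hy
  have hFy : 0 < F y := (mul_pos hc hy').trans_le (hF y)
  rw [div_le_div_iff₀ hFy hc]
  calc ξ y * c ≤ ‖ξ‖ * ‖y‖ * c := by
        gcongr
        exact (le_abs_self _).trans (ξ.le_opNorm y)
    _ = ‖ξ‖ * (c * ‖y‖) := by ring
    _ ≤ ‖ξ‖ * F y := by gcongr; exact hF y

lemma div_le_dualGauge (hc : 0 < c) (hF : ∀ y, c * ‖y‖ ≤ F y) (ξ : E →L[ℝ] ℝ) {y : E}
    (hy : y ≠ 0) : ξ y / F y ≤ dualGauge F ξ :=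
  le_ciSup (f := fun y : {y : E // y ≠ 0} ↦ ξ (y : E) / F (y : E))
    ⟨‖ξ‖ / c, forall_mem_range.2 fun z ↦ div_le_opNorm_div hc hF ξ z.2⟩ ⟨y, hy⟩

lemma abs_apply_le_dualGauge_mul (hc : 0 < c) (hF : ∀ y, c * ‖y‖ ≤ F y)
    (hF_neg : ∀ y, F (-y) = F y) (ξ : E →L[ℝ] ℝ) {y : E} (hy : y ≠ 0) :
    |ξ y| ≤ dualGauge F ξ * F y := by
  have hFy : 0 < F y := (mul_pos hc (norm_pos_iff.2 hy)).trans_le (hF y)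
  have h₁ := div_le_dualGauge hc hF ξ hy
  have h₂ := div_le_dualGauge hc hF ξ (neg_ne_zero.2 hy)
  rw [hF_neg, map_neg] at h₂
  exact abs_le'.2 ⟨(div_le_iff₀ hFy).1 h₁, (div_le_iff₀ hFy).1 h₂⟩

lemma dualGauge_nonneg [Nontrivial E] (hc : 0 < c) (hF : ∀ y, c * ‖y‖ ≤ F y)
    (hF_neg : ∀ y, F (-y) = F y) (ξ : E →L[ℝ] ℝ) : 0 ≤ dualGauge F ξ := by
  obtain ⟨y, hy⟩ := exists_ne (0 : E)
  have hFy : 0 < F y := (mul_pos hc (norm_pos_iff.2 hy)).trans_le (hF y)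
  exact nonneg_of_mul_nonneg_left
    ((abs_nonneg _).trans (abs_apply_le_dualGauge_mul hc hF hF_neg ξ hy)) hFy

lemma dualGauge_zero : dualGauge F 0 = 0 := by
  simp [dualGauge]

lemma continuous_dualGauge [Nontrivial E] (hc : 0 < c) (hF : ∀ y, c * ‖y‖ ≤ F y) :
    Continuous (dualGauge F) := by
  refine (LipschitzWith.of_le_add_mul' c⁻¹ fun ξ η ↦ ?_).continuous
  obtain ⟨y, hy⟩ := exists_ne (0 : E)
  have : Nonempty {y : E // y ≠ 0} := ⟨⟨y, hy⟩⟩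
  refine ciSup_le fun z ↦ ?_
  have h₁ := div_le_dualGauge hc hF η z.2
  have h₂ := div_le_opNorm_div hc hF (ξ - η) z.2
  rw [sub_apply, sub_div] at h₂
  rw [dist_eq_norm, inv_mul_eq_div]
  linarith

/-- Hardy's inequality for a gauge, in terms of lower Lebesgue integrals. -/
lemma lintegral_rpow_div_gauge_le [FiniteDimensional ℝ E] [Nontrivial E] [MeasurableSpace E]
    [BorelSpace E] (μ : Measure E) [μ.IsAddHaarMeasure] {p : ℝ} (hp : 1 < p)
    (hpn : p < Module.finrank ℝ E) (hc : 0 < c) (hF : ∀ y, c * ‖y‖ ≤ F y) (hF0 : F 0 = 0)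
    (hF_neg : ∀ y, F (-y) = F y) {u : E → ℝ} (hu : ContDiff ℝ 1 u) (hus : HasCompactSupport u) :
    ∫⁻ x, ENNReal.ofReal (|u x| ^ p / F x ^ p) ∂μ ≤
      ENNReal.ofReal (p / (Module.finrank ℝ E - p)) ^ p *
        ∫⁻ x, ENNReal.ofReal (dualGauge F (fderiv ℝ u x) ^ p) ∂μ := by
  have hp0 : 0 < p := by linarith
  have hcont : Continuous fun x ↦ dualGauge F (fderiv ℝ u x) :=
    (continuous_dualGauge hc hF).comp (hu.continuous_fderiv one_ne_zero)
  have hradial := lintegral_rpow_radial_le μ hp hpn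
    (g := fun x ↦ ENNReal.ofReal (dualGauge F (fderiv ℝ u x)))
    hcont.measurable.ennreal_ofReal
  simp only [ENNReal.ofReal_rpow_of_nonneg (dualGauge_nonneg hc hF hF_neg _) hp0.le] at hradial
  refine (lintegral_mono fun x ↦ ?_).trans hradial
  rcases eq_or_ne x 0 with rfl | hx
  · simp [hF0, Real.zero_rpow hp0.ne']
  have hFx : 0 < F x := (mul_pos hc (norm_pos_iff.2 hx)).trans_le (hF x)
  rw [← Real.div_rpow (abs_nonneg _) hFx.le,
    ← ENNReal.ofReal_rpow_of_nonneg (div_nonneg (abs_nonneg _) hFx.le) hp0.le]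
  refine ENNReal.rpow_le_rpow ?_ hp0.le
  rw [ENNReal.ofReal_div_of_pos hFx]
  refine ENNReal.div_le_of_le_mul ?_
  rw [← Real.enorm_eq_ofReal_abs, ← lintegral_mul_const' _ _ ENNReal.ofReal_ne_top]
  refine (enorm_le_setLIntegral_radial_fderiv hu hus hx).trans (lintegral_mono fun t ↦ ?_)
  simp only
  rw [Real.enorm_eq_ofReal_abs, ← ENNReal.ofReal_mul (dualGauge_nonneg hc hF hF_neg _)]
  exact ENNReal.ofReal_le_ofReal (abs_apply_le_dualGauge_mul hc hF hF_neg _ hx)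

end DualNorm

/-- The Hardy inequality in a reversible Minkowski space (Euclidean underlying space). -/
theorem stmt_5 (n : ℕ) (p : ℝ) (hp : 1 < p) (hpn : p < n)
    (F : EuclideanSpace ℝ (Fin n) → ℝ)
    (hF_nonneg : ∀ y, 0 ≤ F y)
    (hF_zero : ∀ y, F y = 0 ↔ y = 0)
    (hF_homog : ∀ (c : ℝ) y, F (c • y) = |c| * F y)
    (hF_triangle : ∀ y z, F (y + z) ≤ F y + F z)
    (hF_smooth : ContDiffOn ℝ (⊤ : ℕ∞) F {y | y ≠ 0})
    (Fstar : (EuclideanSpace ℝ (Fin n) →L[ℝ] ℝ) → ℝ)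
    (hFstar : ∀ ξ, Fstar ξ = ⨆ y : {y : EuclideanSpace ℝ (Fin n) // y ≠ 0},
        ξ (y : EuclideanSpace ℝ (Fin n)) / F (y : EuclideanSpace ℝ (Fin n)))
    (Ω : Set (EuclideanSpace ℝ (Fin n))) (hΩ : IsOpen Ω)
    (u : EuclideanSpace ℝ (Fin n) → ℝ)
    (hu : ContDiff ℝ (⊤ : ℕ∞) u) (husupp : HasCompactSupport u) (huΩ : tsupport u ⊆ Ω) :
    ((n - p) / p) ^ p * ∫ x in Ω, |u x| ^ p / (F x) ^ p
      ≤ ∫ x in Ω, (Fstar (fderiv ℝ u x)) ^ p := by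
  have hp0 : 0 < p := by linarith
  have hnp : 0 < (n : ℝ) - p := sub_pos.2 hpn
  have hn : 0 < n := by exact_mod_cast hp0.trans hpn
  have : Nonempty (Fin n) := ⟨⟨0, hn⟩⟩
  obtain rfl : Fstar = dualGauge F := funext hFstar
  have hF_neg (y) : F (-y) = F y := by simpa using hF_homog (-1) y
  obtain ⟨c, hc, hF⟩ := exists_pos_mul_norm_le_of_homogeneous
    (fun y hy ↦ (hF_nonneg y).lt_of_ne' (mt (hF_zero y).1 hy)) hF_homog hF_smooth.continuousOn
  have hu1 : ContDiff ℝ 1 u := hu.of_le (by exact_mod_cast le_top)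
  have hnonneg (ξ) : 0 ≤ dualGauge F ξ := dualGauge_nonneg hc hF hF_neg ξ
  have hL : ∫ x in Ω, |u x| ^ p / F x ^ p = ∫ x, |u x| ^ p / F x ^ p :=
    setIntegral_eq_integral_of_forall_compl_eq_zero fun x hx ↦ by
      rw [image_eq_zero_of_notMem_tsupport (fun h ↦ hx (huΩ h)), abs_zero,
        Real.zero_rpow hp0.ne', zero_div]
  have hzero {x} (hx : x ∉ tsupport u) : dualGauge F (fderiv ℝ u x) ^ p = 0 := by
    rw [image_eq_zero_of_notMem_tsupport (fun h ↦ hx (tsupport_fderiv_subset ℝ h)),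
      dualGauge_zero, Real.zero_rpow hp0.ne']
  have hR : ∫ x in Ω, dualGauge F (fderiv ℝ u x) ^ p = ∫ x, dualGauge F (fderiv ℝ u x) ^ p :=
    setIntegral_eq_integral_of_forall_compl_eq_zero fun x hx ↦ hzero fun h ↦ hx (huΩ h)
  have hint : Integrable fun x ↦ dualGauge F (fderiv ℝ u x) ^ p :=
    (((continuous_dualGauge hc hF).comp (hu1.continuous_fderiv one_ne_zero)).rpow_const
      fun _ ↦ Or.inr hp0.le).integrable_of_hasCompactSupport
      (HasCompactSupport.intro husupp.isCompact fun _ ↦ hzero)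
  have hbound := lintegral_rpow_div_gauge_le volume hp (by simpa using hpn) hc hF
    ((hF_zero 0).2 rfl) hF_neg hu1 husupp
  have hle : ∫ x, |u x| ^ p / F x ^ p ≤
      (p / (n - p)) ^ p * ∫ x, dualGauge F (fderiv ℝ u x) ^ p := by
    rw [← ofReal_integral_eq_lintegral_ofReal hint
      (Filter.Eventually.of_forall fun x ↦ Real.rpow_nonneg (hnonneg _) p),
      finrank_euclideanSpace_fin, ENNReal.ofReal_rpow_of_nonneg (by positivity) hp0.le,
      ← ENNReal.ofReal_mul (by positivity)] at hbound
    have hnorm := norm_integral_le_lintegral_norm (μ := volume) fun x ↦ |u x| ^ p / F x ^ p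
    simp only [Real.norm_of_nonneg (div_nonneg (Real.rpow_nonneg (abs_nonneg (u _)) p)
      (Real.rpow_nonneg (hF_nonneg _) p))] at hnorm
    exact (le_abs_self _).trans (hnorm.trans (ENNReal.toReal_le_of_le_ofReal
      (mul_nonneg (by positivity) (integral_nonneg fun x ↦ Real.rpow_nonneg (hnonneg _) p))
      hbound))
  rw [hL, hR]
  calc ((n - p) / p) ^ p * ∫ x, |u x| ^ p / F x ^ p
    _ ≤ ((n - p) / p) ^ p * ((p / (n - p)) ^ p * ∫ x, dualGauge F (fderiv ℝ u x) ^ p) := by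
        gcongr
    _ = ∫ x, dualGauge F (fderiv ℝ u x) ^ p := by
        rw [← mul_assoc, ← Real.mul_rpow (by positivity) (by positivity),
          div_mul_div_cancel₀ hp0.ne', div_self hnp.ne', Real.one_rpow, one_mul]
end

section
/- Let n ≥ 2, R > 0, p ∈ (1, n], and β < -1. For every u ∈ C_c^∞(B(0,R) ∖ {0}) in ℝ^n, with r(x) = |x|, one has ∫_{B(0,R)} (log(R/r))^{p+β} |∇u|^p dx ≥ (|β+1|/p)^p ∫_{B(0,R)} (log(R/r))^β |u|^p / r^p dx. -/
open MeasureTheory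

/-- Integrating the divergence of the vector field `x ↦ h x • x` over the whole space. -/
lemma integral_fderiv_apply_self {E : Type*} [NormedAddCommGroup E] [InnerProductSpace ℝ E]
    [FiniteDimensional ℝ E] [MeasurableSpace E] [BorelSpace E] {μ : Measure E}
    [μ.IsAddHaarMeasure] {h : E → ℝ} (hh : ContDiff ℝ 1 h) (hc : HasCompactSupport h) :
    ∫ x, fderiv ℝ h x x ∂μ = -((Module.finrank ℝ E : ℝ) * ∫ x, h x ∂μ) := by
  let b := stdOrthonormalBasis ℝ E
  have hcont : ∀ v : E, Continuous fun x => fderiv ℝ h x v := fun v =>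
    (hh.continuous_fderiv one_ne_zero).clm_apply continuous_const
  have hint : ∀ i, Integrable (fun x => innerSL ℝ (b i) x * fderiv ℝ h x (b i)) μ := fun i =>
    ((innerSL ℝ (b i)).continuous.mul (hcont _)).integrable_of_hasCompactSupport
      ((hc.fderiv_apply (𝕜 := ℝ) (b i)).mul_left)
  have hexp : ∀ x, fderiv ℝ h x x = ∑ i, innerSL ℝ (b i) x * fderiv ℝ h x (b i) := by
    intro x
    conv_lhs => rw [← b.sum_repr' x]
    rw [map_sum]
    simp only [map_smul, smul_eq_mul, innerSL_apply_apply]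
    rw [b.sum_repr' x]
  have hparts : ∀ i, ∫ x, innerSL ℝ (b i) x * fderiv ℝ h x (b i) ∂μ = -∫ x, h x ∂μ := by
    intro i
    have hone : ∀ x, fderiv ℝ (fun y => innerSL ℝ (b i) y) x (b i) = 1 := by
      intro x
      rw [ContinuousLinearMap.fderiv, innerSL_apply_apply]
      simp
    rw [integral_mul_fderiv_eq_neg_fderiv_mul_of_integrable]
    · simp only [hone, one_mul]
    · simp only [hone, one_mul]
      exact hh.continuous.integrable_of_hasCompactSupport hc
    · exact hint i
    · exact ((innerSL ℝ (b i)).continuous.mul hh.continuous).integrable_of_hasCompactSupport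
        hc.mul_left
    · exact fun x _ => (innerSL ℝ (b i)).differentiableAt
    · exact fun x _ => (hh.differentiable one_ne_zero).differentiableAt
  simp only [hexp]
  rw [integral_finsetSum _ fun i _ => hint i, Finset.sum_congr rfl fun i _ => hparts i]
  simp

/-- Young's inequality in the form `p a ^ (p - 1) b ≤ (p - 1) a ^ p + b ^ p`. -/
lemma mul_rpow_sub_one_mul_le {a b p : ℝ} (ha : 0 ≤ a) (hb : 0 ≤ b) (hp : 1 < p) :
    p * (a ^ (p - 1) * b) ≤ (p - 1) * a ^ p + b ^ p := by
  have hp0 : 0 < p := by linarith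
  have key := Real.geom_mean_le_arith_mean2_weighted (w₁ := (p - 1) / p) (w₂ := 1 / p)
    (by have : 0 ≤ p - 1 := by linarith
        positivity) (by positivity)
    (Real.rpow_nonneg ha p) (Real.rpow_nonneg hb p) (by field_simp; ring)
  rw [← Real.rpow_mul ha, ← Real.rpow_mul hb, mul_div_cancel₀ _ hp0.ne',
    mul_div_cancel₀ _ hp0.ne', Real.rpow_one] at key
  calc p * (a ^ (p - 1) * b) ≤ p * ((p - 1) / p * a ^ p + 1 / p * b ^ p) := by gcongr
    _ = (p - 1) * a ^ p + b ^ p := by field_simp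

/-- The radial derivative of the weight `log (R / ‖x‖) ^ (β + 1) * ‖x‖ ^ (-p)`. -/
lemma fderiv_log_weight_apply_self {E : Type*} [NormedAddCommGroup E] [InnerProductSpace ℝ E]
    {R p β : ℝ} {x : E} (hx : x ≠ 0) (hR : ‖x‖ < R) :
    fderiv ℝ (fun y : E => Real.log (R / ‖y‖) ^ (β + 1) * ‖y‖ ^ (-p)) x x =
      -(β + 1) * Real.log (R / ‖x‖) ^ β * ‖x‖ ^ (-p)
        - p * (Real.log (R / ‖x‖) ^ (β + 1) * ‖x‖ ^ (-p)) := by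
  have hr : 0 < ‖x‖ := norm_pos_iff.2 hx
  have hRp : 0 < R := hr.trans hR
  have hL : 0 < Real.log (R / ‖x‖) := Real.log_pos ((one_lt_div hr).2 hR)
  have hd : DifferentiableAt ℝ (fun y : E => ‖y‖) x := differentiableAt_id.norm ℝ hx
  have hq : HasDerivAt (fun r : ℝ => R / r) (-R / ‖x‖ ^ 2) ‖x‖ := by
    simpa using! (hasDerivAt_const ‖x‖ R).div (hasDerivAt_id ‖x‖) hr.ne'
  have hg := ((hq.log (div_pos hRp hr).ne').rpow_const (p := β + 1) (Or.inl hL.ne')).mul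
    (Real.hasDerivAt_rpow_const (x := ‖x‖) (p := -p) (Or.inl hr.ne'))
  have hf := (hg.comp_hasFDerivAt x hd.hasFDerivAt).fderiv
  have hfun : (fun y : E => Real.log (R / ‖y‖) ^ (β + 1) * ‖y‖ ^ (-p)) =
    ((fun r : ℝ => Real.log (R / r) ^ (β + 1)) * fun r : ℝ => r ^ (-p)) ∘ fun y : E => ‖y‖ := rfl
  rw [hfun, hf, smul_apply, hd.fderiv_norm_self, smul_eq_mul,
    Real.rpow_sub_one hr.ne', add_sub_cancel_right]
  field_simp
  ring

/-- The pointwise inequality behind the logarithmic Hardy inequality, with `U = |u|`, `D = ‖∇u‖`,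
`L = log (R / r)` and `W` the radial derivative of `|u| ^ p`. -/
lemma log_hardy_pointwise {n p β c r L U D W : ℝ} (hp : 1 < p) (hpn : p ≤ n) (hr : 0 < r)
    (hL : 0 < L) (hU : 0 ≤ U) (hD : 0 ≤ D) (hc : 0 < c) (hcβ : p * c = -(β + 1))
    (hW : -(p * U ^ (p - 1) * D * r) ≤ W) :
    c ^ p * (L ^ β * (U ^ p / r ^ p)) ≤ L ^ (p + β) * D ^ p + c ^ (p - 1) *
      (n * (U ^ p * (L ^ (β + 1) * r ^ (-p))) + (U ^ p * (-(β + 1) * L ^ β * r ^ (-p)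
        - p * (L ^ (β + 1) * r ^ (-p))) + L ^ (β + 1) * r ^ (-p) * W)) := by
  have young := mul_rpow_sub_one_mul_le (a := c * (U / r)) (b := L * D) (p := p)
    (by positivity) (by positivity) hp
  rw [Real.mul_rpow hc.le (by positivity), Real.mul_rpow hc.le (by positivity),
    Real.mul_rpow hL.le hD, Real.div_rpow hU hr.le, Real.div_rpow hU hr.le] at young
  have hcp : c ^ p = c ^ (p - 1) * c := by
    rw [Real.rpow_sub_one hc.ne']; field_simp
  have hrp : r ^ p = r ^ (p - 1) * r := by
    rw [Real.rpow_sub_one hr.ne']; field_simp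
  have hW' := mul_le_mul_of_nonneg_left hW
    (show 0 ≤ c ^ (p - 1) * (L ^ (β + 1) * r ^ (-p)) by positivity)
  have hy := mul_le_mul_of_nonneg_left young (show 0 ≤ L ^ β by positivity)
  have hn : 0 ≤ c ^ (p - 1) * ((n - p) * (U ^ p * (L ^ (β + 1) * r ^ (-p)))) := by
    have : 0 ≤ n - p := by linarith
    positivity
  have hexch : c ^ (p - 1) * (L ^ (β + 1) * r ^ (-p)) * (p * U ^ (p - 1) * D * r) =
      L ^ β * (p * (c ^ (p - 1) * (U ^ (p - 1) / r ^ (p - 1)) * (L * D))) := by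
    rw [Real.rpow_neg hr.le, Real.rpow_add_one hL.ne', hrp]
    field_simp
  have hmain : c ^ (p - 1) * (U ^ p * (-(β + 1) * L ^ β * r ^ (-p))) =
      p * (L ^ β * (c ^ p * (U ^ p / r ^ p))) := by
    rw [← hcβ, Real.rpow_neg hr.le, hcp]
    field_simp
  rw [Real.rpow_add hL]
  linarith

/-- Logarithmic Hardy inequality on the Euclidean ball B(0,R). -/
theorem stmt_8 (n : ℕ) (hn : 2 ≤ n) (R p β : ℝ) (hR : 0 < R)
    (hp1 : 1 < p) (hpn : p ≤ n) (hβ : β < -1)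
    (u : EuclideanSpace ℝ (Fin n) → ℝ)
    (hu : ContDiff ℝ (⊤ : ℕ∞) u) (husupp : HasCompactSupport u)
    (huΩ : tsupport u ⊆ Metric.ball (0 : EuclideanSpace ℝ (Fin n)) R \ {0}) :
    ∫ x in Metric.ball (0 : EuclideanSpace ℝ (Fin n)) R,
        (Real.log (R / ‖x‖)) ^ (p + β) * ‖fderiv ℝ u x‖ ^ p
      ≥ (|β + 1| / p) ^ p *
        ∫ x in Metric.ball (0 : EuclideanSpace ℝ (Fin n)) R,
          (Real.log (R / ‖x‖)) ^ β * (|u x| ^ p / ‖x‖ ^ p) := by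
  have hp0 : 0 < p := by linarith
  set c := |β + 1| / p with hc_def
  have hc : 0 < c := div_pos (abs_pos.2 (by linarith)) hp0
  have hcβ : p * c = -(β + 1) := by
    rw [hc_def, mul_div_cancel₀ _ hp0.ne', abs_of_neg (by linarith)]
  have hu1 : ContDiff ℝ 1 u := hu.of_le (by exact_mod_cast le_top)
  set K := tsupport u with hK
  have hKc : IsCompact K := husupp
  have hKb : K ⊆ Metric.ball 0 R := fun x hx => (huΩ hx).1
  have hne : ∀ x ∈ K, x ≠ 0 := fun x hx => (huΩ hx).2
  have hlt : ∀ x ∈ K, ‖x‖ < R := fun x hx => by simpa using (huΩ hx).1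
  have hnorm : ∀ x ∈ K, 0 < ‖x‖ := fun x hx => norm_pos_iff.2 (hne x hx)
  have hL : ∀ x ∈ K, 0 < Real.log (R / ‖x‖) := fun x hx =>
    Real.log_pos ((one_lt_div (hnorm x hx)).2 (hlt x hx))
  have hu0 : ∀ x ∉ K, u x = 0 := fun x hx => image_eq_zero_of_notMem_tsupport hx
  have hDu0 : ∀ x ∉ K, fderiv ℝ u x = 0 := fun x hx =>
    image_eq_zero_of_notMem_tsupport fun h => hx (tsupport_fderiv_subset ℝ h)
  let w : EuclideanSpace ℝ (Fin n) → ℝ := fun x => ‖u x‖ ^ p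
  let φ : EuclideanSpace ℝ (Fin n) → ℝ := fun x => Real.log (R / ‖x‖) ^ (β + 1) * ‖x‖ ^ (-p)
  have hw : ContDiff ℝ 1 w := hu1.norm_rpow hp1
  have hφ : ∀ x ∈ K, ContDiffAt ℝ 1 φ x := fun x hx => by
    have h1 : ContDiffAt ℝ 1 (fun y : EuclideanSpace ℝ (Fin n) => ‖y‖) x :=
      contDiffAt_id.norm ℝ (hne x hx)
    exact ((((contDiffAt_const (c := R)).div h1 (hnorm x hx).ne').log
      (div_pos hR (hnorm x hx)).ne').rpow_const_of_ne (hL x hx).ne').mul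
        (h1.rpow_const_of_ne (hnorm x hx).ne')
  let h : EuclideanSpace ℝ (Fin n) → ℝ := fun x => w x * φ x
  have hh0 : ∀ x ∉ K, h x = 0 := fun x hx => by simp [h, w, hu0 x hx, hp0.ne']
  have hhs : tsupport h ⊆ K := closure_minimal
    (fun x hx => by_contra fun hxK => hx (hh0 x hxK)) (isClosed_tsupport u)
  have hhc : HasCompactSupport h := hKc.of_isClosed_subset (isClosed_tsupport h) hhs
  have hh : ContDiff ℝ 1 h := contDiff_iff_contDiffAt.2 fun x => by
    by_cases hx : x ∈ K
    · exact hw.contDiffAt.mul (hφ x hx)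
    · refine contDiffAt_const (c := (0 : ℝ)).congr_of_eventuallyEq ?_
      filter_upwards [(isClosed_tsupport u).isOpen_compl.mem_nhds hx] with y hy using hh0 y hy
  have hdivc : Continuous fun x => n * h x + fderiv ℝ h x x :=
    (continuous_const.mul hh.continuous).add
      ((hh.continuous_fderiv one_ne_zero).clm_apply continuous_id)
  have hint1 : Integrable h := hh.continuous.integrable_of_hasCompactSupport hhc
  have hDh0 : ∀ x ∉ K, fderiv ℝ h x = 0 := fun x hx =>
    image_eq_zero_of_notMem_tsupport fun h' => hx (hhs (tsupport_fderiv_subset ℝ h'))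
  have hint2 : Integrable fun x => fderiv ℝ h x x :=
    ((hh.continuous_fderiv one_ne_zero).clm_apply continuous_id).integrable_of_hasCompactSupport
      (HasCompactSupport.intro hKc fun x hx => by simp [hDh0 x hx])
  have hdiv : ∫ x in K, (n * h x + fderiv ℝ h x x) = 0 := by
    rw [setIntegral_eq_integral_of_forall_compl_eq_zero
      fun x hx => by simp [hh0 x hx, hDh0 x hx],
      integral_add (hint1.const_mul _) hint2, integral_const_mul, integral_fderiv_apply_self hh hhc]
    simp
  have hlogc : ContinuousOn (fun x : EuclideanSpace ℝ (Fin n) => Real.log (R / ‖x‖)) K :=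
    (continuousOn_const.div continuous_norm.continuousOn fun x hx => (hnorm x hx).ne').log
      fun x hx => (div_pos hR (hnorm x hx)).ne'
  have hlogpow : ∀ q : ℝ, ContinuousOn
      (fun x : EuclideanSpace ℝ (Fin n) => Real.log (R / ‖x‖) ^ q) K := fun q =>
    hlogc.rpow_const fun x hx => Or.inl (hL x hx).ne'
  have hintl : IntegrableOn
      (fun x => Real.log (R / ‖x‖) ^ (p + β) * ‖fderiv ℝ u x‖ ^ p) K :=
    ((hlogpow _).mul ((hu1.continuous_fderiv one_ne_zero).norm.rpow_const
      fun _ => Or.inr hp0.le).continuousOn).integrableOn_compact hKc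
  have hintr : IntegrableOn
      (fun x => Real.log (R / ‖x‖) ^ β * (|u x| ^ p / ‖x‖ ^ p)) K :=
    ((hlogpow _).mul ((hu1.continuous.abs.rpow_const fun _ => Or.inr hp0.le).continuousOn.div
      (continuous_norm.rpow_const fun _ => Or.inr hp0.le).continuousOn
      fun x hx => (Real.rpow_pos_of_pos (hnorm x hx) p).ne')).integrableOn_compact hKc
  have hintd : IntegrableOn (fun x => n * h x + fderiv ℝ h x x) K :=
    hdivc.continuousOn.integrableOn_compact hKc
  rw [ge_iff_le,
    setIntegral_eq_of_subset_of_forall_sdiff_eq_zero measurableSet_ball hKb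
      (fun x hx => by simp [hu0 x hx.2, hp0.ne']),
    setIntegral_eq_of_subset_of_forall_sdiff_eq_zero measurableSet_ball hKb
      (fun x hx => by simp [hDu0 x hx.2, hp0.ne']), ← integral_const_mul]
  calc _ ≤ ∫ x in K, (Real.log (R / ‖x‖) ^ (p + β) * ‖fderiv ℝ u x‖ ^ p +
        c ^ (p - 1) * (n * h x + fderiv ℝ h x x)) := by
        refine setIntegral_mono_on (hintr.const_mul _) (hintl.add (hintd.const_mul _))
          hKc.measurableSet fun x hx => ?_
        have hprod : fderiv ℝ h x x = w x * fderiv ℝ φ x x + φ x * fderiv ℝ w x x := by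
          rw [fderiv_fun_mul (hw.differentiable one_ne_zero).differentiableAt
            ((hφ x hx).differentiableAt one_ne_zero)]
          simp
        have hW : -(p * |u x| ^ (p - 1) * ‖fderiv ℝ u x‖ * ‖x‖) ≤ fderiv ℝ w x x := by
          refine (abs_le.1 (((fderiv ℝ w x).le_opNorm x).trans ?_)).1
          gcongr
          exact norm_fderiv_norm_rpow_le (hu1.differentiable one_ne_zero) hp1
        rw [hprod, fderiv_log_weight_apply_self (hne x hx) (hlt x hx)]
        exact log_hardy_pointwise hp1 hpn (hnorm x hx) (hL x hx) (abs_nonneg _) (norm_nonneg _)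
          hc hcβ hW
    _ = _ := by
        rw [integral_add hintl (hintd.const_mul _), integral_const_mul, hdiv, mul_zero, add_zero]
end

section
/- Let p > 1, α ∈ ℝ with p - 1 - α ≠ 0, and ρ : Ω → (0,∞) a smooth function on an open set Ω ⊆ ℝ^n such that (p-1-α)·(-Δ_p ρ) ≥ 0 pointwise, where Δ_p ρ = div(|∇ρ|^{p-2}∇ρ). Then for every u ∈ C_c^∞(Ω), ∫_Ω ρ^α |∇u|^p dx ≥ (|p-1-α|/p)^p ∫_Ω (|∇ρ|^p / ρ^{p-α}) |u|^p dx, provided additionally |∇ρ|^p/ρ^{p-α} and ρ^α are locally integrable when α > p. -/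
open MeasureTheory

/-- The divergence (trace of the derivative) of a vector field on ℝ^n. -/
noncomputable def vdiv17 {n : ℕ}
    (V : EuclideanSpace ℝ (Fin n) → EuclideanSpace ℝ (Fin n))
    (x : EuclideanSpace ℝ (Fin n)) : ℝ :=
  LinearMap.trace ℝ (EuclideanSpace ℝ (Fin n)) (fderiv ℝ V x : _ →ₗ[ℝ] _)

section WeakDivergence

open Set Filter Topology

variable {E : Type} [NormedAddCommGroup E] [InnerProductSpace ℝ E]

lemma hasCompactSupport_fderiv_apply {φ : E → ℝ} (hφ : HasCompactSupport φ) (F : E → E) :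
    HasCompactSupport fun x => fderiv ℝ φ x (F x) := by
  refine (hφ.fderiv (𝕜 := ℝ)).mono fun x hx => ?_
  contrapose! hx
  simp only [Function.mem_support, ne_eq, not_not] at hx ⊢
  simp [hx]

variable [MeasurableSpace E]

/-- `F` has nonpositive divergence, tested against nonnegative `C¹` functions supported in `U`. -/
def WeakDivNonpos (μ : Measure E) (F : E → E) (U : Set E) : Prop :=
  ∀ φ : E → ℝ, ContDiff ℝ 1 φ → HasCompactSupport φ → tsupport φ ⊆ U → (∀ x, 0 ≤ φ x) →
    0 ≤ ∫ x, fderiv ℝ φ x (F x) ∂μ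

variable [BorelSpace E] {μ : Measure E} {F : E → E}

lemma integrable_fderiv_apply [IsFiniteMeasureOnCompacts μ] {φ : E → ℝ} (hφ : ContDiff ℝ 1 φ)
    (hc : HasCompactSupport φ) (hF : Continuous F) :
    Integrable (fun x => fderiv ℝ φ x (F x)) μ :=
  ((hφ.continuous_fderiv one_ne_zero).clm_apply hF).integrable_of_hasCompactSupport
    (hasCompactSupport_fderiv_apply hc F)

variable [FiniteDimensional ℝ E] [μ.IsAddHaarMeasure]

/-- Integration by parts for a vector field which is `C¹` near the support of the test function. -/
lemma integral_fderiv_apply_eq_neg_integral_trace {φ : E → ℝ} (hφ : ContDiff ℝ 1 φ)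
    (hc : HasCompactSupport φ) (hF : Continuous F)
    (hF1 : ∀ x ∈ tsupport φ, ContDiffAt ℝ 1 F x) :
    Integrable (fun x => φ x * LinearMap.trace ℝ E (fderiv ℝ F x : E →ₗ[ℝ] E)) μ ∧
    ∫ x, fderiv ℝ φ x (F x) ∂μ =
      -∫ x, φ x * LinearMap.trace ℝ E (fderiv ℝ F x : E →ₗ[ℝ] E) ∂μ := by
  let b := stdOrthonormalBasis ℝ E
  let f : Fin (Module.finrank ℝ E) → E → ℝ := fun i x => inner ℝ (b i) (F x)
  have hf : ∀ i, Continuous (f i) := fun i => continuous_const.inner hF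
  have hf1 : ∀ i, ∀ x ∈ tsupport φ, ContDiffAt ℝ 1 (f i) x := fun i x hx =>
    contDiffAt_const.inner ℝ (hF1 x hx)
  have hdf : ∀ i, ∀ x ∈ tsupport φ, fderiv ℝ (f i) x (b i) = inner ℝ (b i) (fderiv ℝ F x (b i)) := by
    intro i x hx
    have h := (hF1 x hx).differentiableAt one_ne_zero
    have := fderiv_inner_apply ℝ (f := fun _ => b i) (differentiableAt_const _) h (b i)
    simpa [f] using this
  have key : ∀ x, φ x * LinearMap.trace ℝ E (fderiv ℝ F x : E →ₗ[ℝ] E) =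
      ∑ i, fderiv ℝ (f i) x (b i) * φ x := by
    intro x
    by_cases hx : x ∈ tsupport φ
    · rw [LinearMap.trace_eq_sum_inner _ b, Finset.mul_sum]
      exact Finset.sum_congr rfl fun i _ => by rw [hdf i x hx, mul_comm]; rfl
    · simp [image_eq_zero_of_notMem_tsupport hx]
  have key2 : ∀ x, fderiv ℝ φ x (F x) = ∑ i, f i x * fderiv ℝ φ x (b i) := by
    intro x
    conv_lhs => rw [← b.sum_repr' (F x)]
    simp [f]
  have i1 : ∀ i, Integrable (fun x => fderiv ℝ (f i) x (b i) * φ x) μ := by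
    intro i
    refine Continuous.integrable_of_hasCompactSupport ?_ hc.mul_left
    refine continuous_of_tsupport fun x hx => ?_
    have hx' : x ∈ tsupport φ := tsupport_mul_subset_right hx
    have h := ((hf1 i x hx').fderiv_right (m := 0) (by simp)).continuousAt
    exact (h.clm_apply continuousAt_const).mul hφ.continuous.continuousAt
  have i2 : ∀ i, Integrable (fun x => f i x * fderiv ℝ φ x (b i)) μ := by
    intro i
    exact ((hf i).mul ((hφ.continuous_fderiv one_ne_zero).clm_apply continuous_const)
      ).integrable_of_hasCompactSupport (hasCompactSupport_fderiv_apply hc _).mul_left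
  constructor
  · simp_rw [key]
    exact integrable_finsetSum _ fun i _ => i1 i
  simp_rw [key, key2]
  rw [integral_finsetSum _ fun i _ => i1 i, integral_finsetSum _ fun i _ => i2 i,
    ← Finset.sum_neg_distrib]
  refine Finset.sum_congr rfl fun i _ => ?_
  refine integral_mul_fderiv_eq_neg_fderiv_mul_of_integrable (i1 i) (i2 i) ?_ ?_ ?_
  · exact ((hf i).mul hφ.continuous).integrable_of_hasCompactSupport hc.mul_left
  · exact fun x hx => (hf1 i x hx).differentiableAt one_ne_zero
  · exact fun x _ => (hφ.differentiable one_ne_zero) x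

omit [BorelSpace E] [FiniteDimensional ℝ E] [μ.IsAddHaarMeasure] in
lemma WeakDivNonpos.mono {U W : Set E} (h : WeakDivNonpos μ F U) (hWU : W ⊆ U) :
    WeakDivNonpos μ F W :=
  fun φ h1 hc hs h0 => h φ h1 hc (hs.trans hWU) h0

omit [FiniteDimensional ℝ E] in
lemma integral_fderiv_apply_add {φ ψ : E → ℝ} (hφ : ContDiff ℝ 1 φ) (hφc : HasCompactSupport φ)
    (hψ : ContDiff ℝ 1 ψ) (hψc : HasCompactSupport ψ) (hF : Continuous F) :
    ∫ x, fderiv ℝ (fun y => φ y + ψ y) x (F x) ∂μ =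
      ∫ x, fderiv ℝ φ x (F x) ∂μ + ∫ x, fderiv ℝ ψ x (F x) ∂μ := by
  rw [← integral_add (integrable_fderiv_apply hφ hφc hF) (integrable_fderiv_apply hψ hψc hF)]
  congr 1 with x
  rw [fderiv_fun_add (hφ.differentiable one_ne_zero x) (hψ.differentiable one_ne_zero x)]
  rfl

lemma weakDivNonpos_of_finset_cover (hF : Continuous F) (r : E → ℝ) (t : Finset E)
    (hr : ∀ x ∈ t, 0 < r x) (h : ∀ x ∈ t, WeakDivNonpos μ F (Metric.closedBall x (r x)))
    {φ : E → ℝ} (hφ : ContDiff ℝ 1 φ) (hc : HasCompactSupport φ)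
    (hs : Function.support φ ⊆ ⋃ x ∈ t, Metric.ball x (r x / 2)) (h0 : ∀ x, 0 ≤ φ x) :
    0 ≤ ∫ x, fderiv ℝ φ x (F x) ∂μ := by
  classical
  induction t using Finset.induction_on generalizing φ with
  | empty =>
    have : φ = fun _ => 0 := by
      ext x
      by_contra hx
      simpa using hs hx
    simp [this]
  | insert a t _ ih =>
    have ha := hr a (Finset.mem_insert_self a t)
    let b : ContDiffBump a := ⟨r a / 2, r a, by positivity, by linarith⟩
    have hb : ContDiff ℝ 1 (b : E → ℝ) := b.contDiff
    have h1 : ContDiff ℝ 1 fun y => φ y * b y := hφ.mul hb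
    have h2 : ContDiff ℝ 1 fun y => φ y * (1 - b y) := hφ.mul (contDiff_const.sub hb)
    have c1 : HasCompactSupport fun y => φ y * b y := hc.mul_right
    have c2 : HasCompactSupport fun y => φ y * (1 - b y) := hc.mul_right
    have hsum : φ = fun y => φ y * b y + φ y * (1 - b y) := by ext y; ring
    rw [hsum, integral_fderiv_apply_add h1 c1 h2 c2 hF]
    refine add_nonneg (h a (Finset.mem_insert_self a t) _ h1 c1 ?_ fun x => ?_)
      (ih (fun x hx => hr x (Finset.mem_insert_of_mem hx))
        (fun x hx => h x (Finset.mem_insert_of_mem hx)) h2 c2 ?_ fun x => ?_)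
    · exact tsupport_mul_subset_right.trans b.tsupport_eq.subset
    · exact mul_nonneg (h0 x) b.nonneg
    · intro x hx
      have hx1 : φ x ≠ 0 := left_ne_zero_of_mul hx
      have hx2 : 1 - b x ≠ 0 := right_ne_zero_of_mul hx
      have hxa : x ∉ Metric.ball a (r a / 2) := fun hxa =>
        hx2 (by rw [b.one_of_mem_closedBall (Metric.ball_subset_closedBall hxa), sub_self])
      have := hs hx1
      simp only [Finset.mem_insert, iUnion_iUnion_eq_or_left, mem_union] at this
      exact this.resolve_left hxa
    · exact mul_nonneg (h0 x) (sub_nonneg.2 b.le_one)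

/-- Having nonpositive weak divergence is a local property. -/
lemma weakDivNonpos_of_locally (hF : Continuous F) {U : Set E}
    (h : ∀ x ∈ U, ∃ N ∈ 𝓝 x, WeakDivNonpos μ F N) : WeakDivNonpos μ F U := by
  intro φ hφ hc hs h0
  have h' : ∀ x, ∃ r : ℝ, 0 < r ∧ (x ∈ U → WeakDivNonpos μ F (Metric.closedBall x r)) := by
    intro x
    by_cases hx : x ∈ U
    · obtain ⟨N, hN, hW⟩ := h x hx
      obtain ⟨r, hr, hrN⟩ := Metric.nhds_basis_closedBall.mem_iff.1 hN
      exact ⟨r, hr, fun _ => hW.mono hrN⟩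
    · exact ⟨1, one_pos, fun h => absurd h hx⟩
  choose r hr hW using h'
  obtain ⟨t, ht, htc⟩ := IsCompact.elim_nhds_subcover hc (fun x => Metric.ball x (r x / 2))
    fun x _ => Metric.ball_mem_nhds x (half_pos (hr x))
  exact weakDivNonpos_of_finset_cover hF r t (fun x _ => hr x)
    (fun x hx => hW x (hs (ht x hx))) hφ hc ((subset_tsupport φ).trans htc) h0

/-- Test functions which are bounded in `BV` and converge to zero almost everywhere
converge weakly to zero against continuous vector fields. -/
lemma tendsto_integral_fderiv_apply_zero (hF : Continuous F) {φ : ℕ → E → ℝ} {ψ : E → ℝ}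
    {C : ℝ} (hφ : ∀ k, ContDiff ℝ 1 (φ k)) (hψ : Continuous ψ) (hψc : HasCompactSupport ψ)
    (hs : ∀ k x, |φ k x| ≤ ψ x) (hC : ∀ k, ∫ x, ‖fderiv ℝ (φ k) x‖ ∂μ ≤ C)
    (h0 : ∀ᵐ x ∂μ, Tendsto (fun k => φ k x) atTop (𝓝 0)) :
    Tendsto (fun k => ∫ x, fderiv ℝ (φ k) x (F x) ∂μ) atTop (𝓝 0) := by
  have hc : ∀ k, HasCompactSupport (φ k) := fun k => hψc.mono fun x hx h => hx <| by
    have := hs k x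
    rw [h] at this
    exact abs_nonpos_iff.1 this
  have hC0 : 0 ≤ C := (integral_nonneg fun _ => norm_nonneg _).trans (hC 0)
  rw [Metric.tendsto_atTop]
  intro ε hε
  obtain ⟨W, hW, hWF, -⟩ := Continuous.exists_contDiff_approx (ε := fun _ => ε / (2 * (C + 1))) 1
    hF continuous_const fun _ => by positivity
  have hW : ContDiff ℝ 1 W := by exact_mod_cast hW
  have hlim : Tendsto (fun k => ∫ x, fderiv ℝ (φ k) x (W x) ∂μ) atTop (𝓝 0) := by
    have hibp := fun k => (integral_fderiv_apply_eq_neg_integral_trace (μ := μ) (hφ k) (hc k)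
      hW.continuous fun x _ => hW.contDiffAt).2
    simp_rw [hibp]
    have htr : Continuous fun x => LinearMap.trace ℝ E (fderiv ℝ W x : E →ₗ[ℝ] E) := by
      have : Continuous fun L : E →L[ℝ] E => LinearMap.trace ℝ E (L : E →ₗ[ℝ] E) :=
        ((LinearMap.trace ℝ E).comp (ContinuousLinearMap.coeLM ℝ)).continuous_of_finiteDimensional
      exact this.comp (hW.continuous_fderiv one_ne_zero)
    rw [← neg_zero]
    refine Tendsto.neg ?_
    rw [← integral_zero E ℝ (μ := μ)]
    refine tendsto_integral_of_dominated_convergence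
      (fun x => ψ x * |LinearMap.trace ℝ E (fderiv ℝ W x : E →ₗ[ℝ] E)|)
      (fun k => ((hφ k).continuous.mul htr).aestronglyMeasurable) ?_ ?_ ?_
    · exact (hψ.mul htr.abs).integrable_of_hasCompactSupport hψc.mul_right
    · intro k
      filter_upwards with x
      rw [Real.norm_eq_abs, abs_mul]
      exact mul_le_mul_of_nonneg_right (hs k x) (abs_nonneg _)
    · filter_upwards [h0] with x hx
      simpa using hx.mul_const _
  obtain ⟨k₀, hk₀⟩ := (Metric.tendsto_atTop.1 hlim) (ε / 2) (half_pos hε)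
  refine ⟨k₀, fun k hk => ?_⟩
  have h1 := hk₀ k hk
  rw [dist_zero_right, Real.norm_eq_abs] at h1 ⊢
  have hi1 := integrable_fderiv_apply (μ := μ) (hφ k) (hc k) hF
  have hi2 := integrable_fderiv_apply (μ := μ) (hφ k) (hc k) hW.continuous
  have h2 : |∫ x, fderiv ℝ (φ k) x (F x) ∂μ - ∫ x, fderiv ℝ (φ k) x (W x) ∂μ| ≤ ε / 2 := by
    rw [← integral_sub hi1 hi2, ← Real.norm_eq_abs]
    have hdi : Integrable (fun x => ‖fderiv ℝ (φ k) x‖) μ :=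
      ((hφ k).continuous_fderiv one_ne_zero).norm.integrable_of_hasCompactSupport
        ((hc k).fderiv (𝕜 := ℝ)).norm
    calc _ ≤ ∫ x, ‖fderiv ℝ (φ k) x‖ * (ε / (2 * (C + 1))) ∂μ := by
          refine norm_integral_le_of_norm_le (hdi.mul_const _) ?_
          filter_upwards with x
          rw [← map_sub]
          refine (ContinuousLinearMap.le_opNorm _ _).trans ?_
          gcongr
          rw [← dist_eq_norm, dist_comm]
          exact (hWF x).le
      _ = (∫ x, ‖fderiv ℝ (φ k) x‖ ∂μ) * (ε / (2 * (C + 1))) := integral_mul_const _ _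
      _ ≤ (C + 1) * (ε / (2 * (C + 1))) := by
          gcongr
          linarith [hC k]
      _ = ε / 2 := by field_simp
  have := abs_sub_abs_le_abs_sub (∫ x, fderiv ℝ (φ k) x (F x) ∂μ) (∫ x, fderiv ℝ (φ k) x (W x) ∂μ)
  linarith

lemma integral_mul_fderiv_le {ψ ζ : E → ℝ} {B : ℝ} (hψ : ContDiff ℝ 1 ψ)
    (hc : HasCompactSupport ψ) (hζ : ContDiff ℝ 1 ζ) (hB : ∀ x, |ζ x| ≤ B) (e : E) :
    ∫ x, ψ x * fderiv ℝ ζ x e ∂μ ≤ B * ∫ x, |fderiv ℝ ψ x e| ∂μ := by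
  have hdψ : Continuous fun x => fderiv ℝ ψ x e :=
    (hψ.continuous_fderiv one_ne_zero).clm_apply continuous_const
  have hdψc : HasCompactSupport fun x => fderiv ℝ ψ x e := hasCompactSupport_fderiv_apply hc _
  have hdζ : Continuous fun x => fderiv ℝ ζ x e :=
    (hζ.continuous_fderiv one_ne_zero).clm_apply continuous_const
  have i1 : Integrable (fun x => fderiv ℝ ψ x e * ζ x) μ :=
    (hdψ.mul hζ.continuous).integrable_of_hasCompactSupport hdψc.mul_right
  rw [integral_mul_fderiv_eq_neg_fderiv_mul_of_integrable i1
    ((hψ.continuous.mul hdζ).integrable_of_hasCompactSupport hc.mul_right)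
    ((hψ.continuous.mul hζ.continuous).integrable_of_hasCompactSupport hc.mul_right)
    (fun x _ => hψ.differentiable one_ne_zero x) (fun x _ => hζ.differentiable one_ne_zero x),
    ← integral_neg, ← integral_const_mul]
  refine integral_mono i1.neg
    ((hdψ.abs.integrable_of_hasCompactSupport hdψc.abs).const_mul B) fun x => ?_
  calc -(fderiv ℝ ψ x e * ζ x) ≤ |fderiv ℝ ψ x e * ζ x| := neg_le_abs _
    _ = |ζ x| * |fderiv ℝ ψ x e| := by rw [abs_mul, mul_comm]
    _ ≤ B * |fderiv ℝ ψ x e| := by gcongr; exact hB x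

/-- A level set of a `C¹` function is null where some directional derivative is positive. -/
lemma ae_ne_zero_of_fderiv_pos {ψ h : E → ℝ} (hψ : ContDiff ℝ 1 ψ) (hc : HasCompactSupport ψ)
    (h0 : ∀ x, 0 ≤ ψ x) (hh : ContDiff ℝ 1 h) {e : E}
    (he : ∀ x ∈ tsupport ψ, 0 < fderiv ℝ h x e) : ∀ᵐ x ∂μ, h x = 0 → ψ x = 0 := by
  have hdh : Continuous fun x => fderiv ℝ h x e :=
    (hh.continuous_fderiv one_ne_zero).clm_apply continuous_const
  have hnn : ∀ x, 0 ≤ ψ x * fderiv ℝ h x e := fun x => by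
    by_cases hx : x ∈ tsupport ψ
    · exact mul_nonneg (h0 x) (he x hx).le
    · simp [image_eq_zero_of_notMem_tsupport hx]
  have hmeas : MeasurableSet {x | h x = 0} := (isClosed_eq hh.continuous continuous_const).measurableSet
  set g : E → ℝ := indicator {x | h x = 0} fun x => ψ x * fderiv ℝ h x e with hg
  have hgi : Integrable g μ :=
    ((hψ.continuous.mul hdh).integrable_of_hasCompactSupport hc.mul_right).indicator hmeas
  have hg0 : ∀ x, 0 ≤ g x := fun x => indicator_nonneg (fun y _ => hnn y) x
  have hle : ∀ k : ℕ, (k : ℝ) * ∫ x, g x ∂μ ≤ 2 * ∫ x, |fderiv ℝ ψ x e| ∂μ := by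
    intro k
    have hζ : ContDiff ℝ 1 fun x => Real.arctan (k * h x) :=
      Real.contDiff_arctan.comp (contDiff_const.mul hh)
    have hd : ∀ x, fderiv ℝ (fun x => Real.arctan (k * h x)) x e =
        1 / (1 + (k * h x) ^ 2) * (k * fderiv ℝ h x e) := by
      intro x
      have := (((hh.differentiable one_ne_zero x).hasFDerivAt.const_mul (k : ℝ)).arctan).fderiv
      rw [this]
      simp
    refine le_trans ?_ (integral_mul_fderiv_le (μ := μ) hψ hc hζ (B := 2) (fun x => ?_) e)
    · rw [← integral_const_mul]
      refine integral_mono (hgi.const_mul _) ?_ fun x => ?_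
      · exact (hψ.continuous.mul ((hζ.continuous_fderiv one_ne_zero).clm_apply
          continuous_const)).integrable_of_hasCompactSupport hc.mul_right
      · simp only [hd]
        by_cases hx : h x = 0
        · simp only [hg, indicator, mem_ofPred_eq, hx, if_true]
          apply le_of_eq
          norm_num
          ring
        · simp only [hg, indicator, mem_ofPred_eq, hx, if_false, mul_zero]
          have := hnn x
          calc (0 : ℝ) ≤ 1 / (1 + (k * h x) ^ 2) * k * (ψ x * fderiv ℝ h x e) := by positivity
            _ = _ := by ring
    · have := Real.pi_lt_four
      have h1 := Real.arctan_lt_pi_div_two (k * h x)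
      have h2 := Real.neg_pi_div_two_lt_arctan (k * h x)
      exact abs_le.2 ⟨by linarith, by linarith⟩
  have hz : ∫ x, g x ∂μ = 0 := by
    refine le_antisymm ?_ (integral_nonneg hg0)
    by_contra! hpos
    obtain ⟨k, hk⟩ := exists_nat_gt ((2 * ∫ x, |fderiv ℝ ψ x e| ∂μ) / ∫ x, g x ∂μ)
    rw [div_lt_iff₀ hpos] at hk
    linarith [hle k]
  rw [integral_eq_zero_iff_of_nonneg hg0 hgi] at hz
  filter_upwards [hz] with x hx hx0
  simp only [hg, indicator, mem_ofPred_eq, hx0, if_true, Pi.zero_apply, mul_eq_zero] at hx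
  by_contra hψx
  exact (he x (subset_tsupport ψ hψx)).ne' (hx.resolve_left hψx)

/-- Hypersurfaces are removable for continuous vector fields of nonpositive divergence. -/
lemma weakDivNonpos_of_hypersurface (hF : Continuous F) {h : E → ℝ} (hh : ContDiff ℝ 1 h)
    {e : E} {N : Set E} (he : ∀ x ∈ N, 0 < fderiv ℝ h x e)
    (hN : WeakDivNonpos μ F (N ∩ {x | h x ≠ 0})) : WeakDivNonpos μ F N := by
  intro ψ hψ hc hs h0
  let σ := Real.smoothTransition
  have hσ : ContDiff ℝ 1 σ := by exact_mod_cast Real.smoothTransition.contDiff (n := 1)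
  have hσd : Differentiable ℝ σ := hσ.differentiable one_ne_zero
  have hσ' : ∀ t, 0 ≤ deriv σ t := fun t => Real.smoothTransition.monotone.deriv_nonneg
  let a : ℕ → E → ℝ := fun k x => σ (k * h x - 1)
  let b : ℕ → E → ℝ := fun k x => σ (-(k * h x) - 1)
  have ha : ∀ k, ContDiff ℝ 1 (a k) := fun k => hσ.comp ((contDiff_const.mul hh).sub contDiff_const)
  have hb : ∀ k, ContDiff ℝ 1 (b k) := fun k =>
    hσ.comp ((contDiff_const.mul hh).neg.sub contDiff_const)
  have hd : ∀ x, HasFDerivAt h (fderiv ℝ h x) x := fun x =>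
    (hh.differentiable one_ne_zero x).hasFDerivAt
  have hda : ∀ k x, HasFDerivAt (a k) (deriv σ (k * h x - 1) • ((k : ℝ) • fderiv ℝ h x)) x :=
    fun k x => (hσd _).hasDerivAt.comp_hasFDerivAt x (((hd x).const_mul (k : ℝ)).sub_const 1)
  have hdb : ∀ k x,
      HasFDerivAt (b k) (deriv σ (-(k * h x) - 1) • -((k : ℝ) • fderiv ℝ h x)) x :=
    fun k x => (hσd _).hasDerivAt.comp_hasFDerivAt x (((hd x).const_mul (k : ℝ)).neg.sub_const 1)
  have ha0 : ∀ k x, 0 ≤ a k x := fun k x => Real.smoothTransition.nonneg _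
  have hb0 : ∀ k x, 0 ≤ b k x := fun k x => Real.smoothTransition.nonneg _
  have ha1 : ∀ k x, a k x ≤ 1 := fun k x => Real.smoothTransition.le_one _
  have hb1 : ∀ k x, b k x ≤ 1 := fun k x => Real.smoothTransition.le_one _
  have hab : ∀ k x, a k x + b k x ≤ 1 := by
    intro k x
    rcases le_total 0 (k * h x) with hx | hx
    · have : b k x = 0 := Real.smoothTransition.zero_of_nonpos (by linarith)
      linarith [ha1 k x]
    · have : a k x = 0 := Real.smoothTransition.zero_of_nonpos (by linarith)
      linarith [hb1 k x]
  have h1 : ∀ k, ContDiff ℝ 1 fun x => ψ x * (a k x + b k x) := fun k => hψ.mul ((ha k).add (hb k))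
  have h2 : ∀ k, ContDiff ℝ 1 fun x => ψ x * (1 - (a k x + b k x)) := fun k =>
    hψ.mul (contDiff_const.sub ((ha k).add (hb k)))
  have hpos : ∀ k, 0 ≤ ∫ x, fderiv ℝ (fun x => ψ x * (a k x + b k x)) x (F x) ∂μ := by
    intro k
    refine hN _ (h1 k) hc.mul_right ?_ fun x => mul_nonneg (h0 x) (add_nonneg (ha0 k x) (hb0 k x))
    refine subset_inter (tsupport_mul_subset_left.trans hs) ?_
    have hcl : IsClosed {x | 1 ≤ |(k : ℝ) * h x|} :=
      isClosed_le continuous_const (continuous_const.mul hh.continuous).abs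
    refine (closure_minimal (fun x hx => ?_) hcl).trans fun x hx hx0 => ?_
    · have hx2 : a k x + b k x ≠ 0 := right_ne_zero_of_mul hx
      by_contra hlt
      rw [mem_ofPred_eq, not_le, abs_lt] at hlt
      refine hx2 ?_
      have e1 : a k x = 0 := Real.smoothTransition.zero_of_nonpos (by linarith)
      have e2 : b k x = 0 := Real.smoothTransition.zero_of_nonpos (by linarith)
      rw [e1, e2, add_zero]
    · rw [mem_ofPred_eq, hx0, mul_zero, abs_zero] at hx
      linarith
  have hsplit : ∀ k, ∫ x, fderiv ℝ ψ x (F x) ∂μ =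
      ∫ x, fderiv ℝ (fun x => ψ x * (a k x + b k x)) x (F x) ∂μ +
      ∫ x, fderiv ℝ (fun x => ψ x * (1 - (a k x + b k x))) x (F x) ∂μ := by
    intro k
    rw [← integral_fderiv_apply_add (h1 k) hc.mul_right (h2 k) hc.mul_right hF]
    have : ψ = fun x => ψ x * (a k x + b k x) + ψ x * (1 - (a k x + b k x)) := by
      ext y
      ring
    rw [← this]
  obtain ⟨A, hA⟩ := IsCompact.exists_bound_of_continuousOn (s := tsupport ψ)
    (f := fun x => ‖fderiv ℝ h x‖ / fderiv ℝ h x e) hc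
    ((hh.continuous_fderiv one_ne_zero).norm.continuousOn.div
      ((hh.continuous_fderiv one_ne_zero).clm_apply continuous_const).continuousOn
      fun x hx => (he x (hs hx)).ne')
  have hA' : ∀ x ∈ tsupport ψ, ‖fderiv ℝ h x‖ ≤ A * fderiv ℝ h x e := fun x hx => by
    rw [← div_le_iff₀ (he x (hs hx))]
    exact (le_abs_self _).trans (hA x hx)
  have hlim : Tendsto (fun k => ∫ x, fderiv ℝ (fun x => ψ x * (1 - (a k x + b k x))) x (F x) ∂μ)
      atTop (𝓝 0) := by
    refine tendsto_integral_fderiv_apply_zero hF h2 hψ.continuous hc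
      (C := ∫ x, ‖fderiv ℝ ψ x‖ ∂μ + |A| * ∫ x, |fderiv ℝ ψ x e| ∂μ) ?_ ?_ ?_
    · intro k x
      rw [abs_mul, abs_of_nonneg (h0 x)]
      refine mul_le_of_le_one_right (h0 x) (abs_le.2 ⟨?_, ?_⟩) <;>
      linarith [hab k x, ha0 k x, hb0 k x]
    · intro k
      have hζ : ContDiff ℝ 1 fun x => a k x - b k x := (ha k).sub (hb k)
      have hdζ : ∀ x, fderiv ℝ (fun x => a k x - b k x) x e =
          (deriv σ (k * h x - 1) + deriv σ (-(k * h x) - 1)) * (k * fderiv ℝ h x e) := by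
        intro x
        have : fderiv ℝ (fun x => a k x - b k x) x = _ := ((hda k x).sub (hdb k x)).fderiv
        rw [this]
        simp
        ring
      have hbd := integral_mul_fderiv_le (μ := μ) hψ hc hζ (B := 1) (fun x => abs_le.2
        ⟨by linarith [ha0 k x, hb1 k x], by linarith [hb0 k x, ha1 k x]⟩) e
      have i1 : Integrable (fun x => ‖fderiv ℝ ψ x‖) μ :=
        (hψ.continuous_fderiv one_ne_zero).norm.integrable_of_hasCompactSupport
          (hc.fderiv (𝕜 := ℝ)).norm
      have i2 : Integrable (fun x => ψ x * fderiv ℝ (fun x => a k x - b k x) x e) μ :=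
        (hψ.continuous.mul ((hζ.continuous_fderiv one_ne_zero).clm_apply
          continuous_const)).integrable_of_hasCompactSupport hc.mul_right
      have i3 : Integrable (fun x => ‖fderiv ℝ (fun x => ψ x * (1 - (a k x + b k x))) x‖) μ :=
        ((h2 k).continuous_fderiv one_ne_zero).norm.integrable_of_hasCompactSupport
          ((hc.mul_right (f' := fun x => 1 - (a k x + b k x))).fderiv (𝕜 := ℝ)).norm
      calc ∫ x, ‖fderiv ℝ (fun x => ψ x * (1 - (a k x + b k x))) x‖ ∂μ
          ≤ ∫ x, (‖fderiv ℝ ψ x‖ + |A| * (ψ x * fderiv ℝ (fun x => a k x - b k x) x e)) ∂μ := by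
            refine integral_mono i3 (i1.add (i2.const_mul _)) fun x => ?_
            have hdx := ((hψ.differentiable one_ne_zero x).hasFDerivAt.mul
              (((hda k x).add (hdb k x)).const_sub 1)).fderiv
            change ‖fderiv ℝ (ψ * fun x => 1 - (a k + b k) x) x‖ ≤ _
            rw [hdx, hdζ]
            have hs0 := add_nonneg (hσ' (k * h x - 1)) (hσ' (-(k * h x) - 1))
            have hn1 : ‖(1 - (a k + b k) x) • fderiv ℝ ψ x‖ ≤ ‖fderiv ℝ ψ x‖ := by
              rw [norm_smul]
              refine mul_le_of_le_one_left (norm_nonneg _) (abs_le.2 ⟨?_, ?_⟩) <;>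
              simp only [Pi.add_apply] <;> linarith [hab k x, ha0 k x, hb0 k x]
            have hn2 : ‖ψ x • -(deriv σ (k * h x - 1) • ((k : ℝ) • fderiv ℝ h x) +
                deriv σ (-(k * h x) - 1) • -((k : ℝ) • fderiv ℝ h x))‖ ≤
                |A| * (ψ x * ((deriv σ (k * h x - 1) + deriv σ (-(k * h x) - 1)) *
                  (k * fderiv ℝ h x e))) := by
              by_cases hx : x ∈ tsupport ψ
              · have hrw : deriv σ (k * h x - 1) • ((k : ℝ) • fderiv ℝ h x) +
                    deriv σ (-(k * h x) - 1) • -((k : ℝ) • fderiv ℝ h x) =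
                    ((deriv σ (k * h x - 1) - deriv σ (-(k * h x) - 1)) * k) • fderiv ℝ h x := by
                  module
                rw [hrw, norm_smul, norm_neg, norm_smul, norm_mul, Real.norm_eq_abs,
                  Real.norm_eq_abs, Real.norm_eq_abs, abs_of_nonneg (h0 x), Nat.abs_cast]
                have ht : |deriv σ (k * h x - 1) - deriv σ (-(k * h x) - 1)| ≤
                    deriv σ (k * h x - 1) + deriv σ (-(k * h x) - 1) :=
                  abs_le.2 ⟨by linarith [hσ' (k * h x - 1)], by linarith [hσ' (-(k * h x) - 1)]⟩
                have hhx : ‖fderiv ℝ h x‖ ≤ |A| * fderiv ℝ h x e :=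
                  (hA' x hx).trans (mul_le_mul_of_nonneg_right (le_abs_self A) (he x (hs hx)).le)
                calc _ ≤ ψ x * ((deriv σ (k * h x - 1) + deriv σ (-(k * h x) - 1)) * k *
                      (|A| * fderiv ℝ h x e)) := by
                      have := h0 x
                      gcongr
                  _ = _ := by ring
              · simp [image_eq_zero_of_notMem_tsupport hx]
            refine (norm_add_le _ _).trans ?_
            rw [add_comm]
            exact add_le_add hn1 hn2
        _ = ∫ x, ‖fderiv ℝ ψ x‖ ∂μ +
            |A| * ∫ x, ψ x * fderiv ℝ (fun x => a k x - b k x) x e ∂μ := by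
            rw [integral_add i1 (i2.const_mul _), integral_const_mul]
        _ ≤ _ := by
            rw [one_mul] at hbd
            gcongr
    · filter_upwards [ae_ne_zero_of_fderiv_pos (μ := μ) hψ hc h0 hh fun x hx => he x (hs hx)]
        with x hx
      by_cases hx0 : h x = 0
      · simp [hx hx0]
      · obtain ⟨k₀, hk₀⟩ := exists_nat_ge (2 / |h x|)
        refine tendsto_const_nhds.congr' ?_
        filter_upwards [eventually_ge_atTop k₀] with k hk
        have hpos : 0 < |h x| := abs_pos.2 hx0
        have hk2 : 2 ≤ k * |h x| := by
          rw [← div_le_iff₀ hpos]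
          exact hk₀.trans (by exact_mod_cast hk)
        suffices hs1 : 1 ≤ a k x + b k x by
          rw [le_antisymm (hab k x) hs1, sub_self, mul_zero]
        rcases abs_cases (h x) with ⟨hx', -⟩ | ⟨hx', -⟩ <;> rw [hx'] at hk2
        · have : a k x = 1 := Real.smoothTransition.one_of_one_le (by linarith)
          linarith [hb0 k x]
        · have : b k x = 1 := Real.smoothTransition.one_of_one_le (by linarith)
          linarith [ha0 k x]
  have hlim' := hlim.const_sub (∫ x, fderiv ℝ ψ x (F x) ∂μ)
  rw [sub_zero] at hlim'
  refine ge_of_tendsto' hlim' fun k => ?_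
  linarith [hpos k, hsplit k]

/-- Smooth cutoff around a closed set with controlled gradient. -/
lemma exists_contDiff_cutoff (K : Set E) {δ : ℝ} (hδ : 0 < δ) :
    ∃ χ : E → ℝ, ContDiff ℝ 1 χ ∧ (∀ x, 0 ≤ χ x ∧ χ x ≤ 1) ∧
      (∀ x, Metric.infDist x K < δ → χ x = 0) ∧ (∀ x, 4 * δ < Metric.infDist x K → χ x = 1) ∧
      ∀ x, ‖fderiv ℝ χ x‖ ≤ 1 / δ := by
  let f : E → ℝ := fun x => max 0 (min 1 ((Metric.infDist x K - 2 * δ) / δ))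
  have hf0 : ∀ x, 0 ≤ f x := fun x => le_max_left _ _
  have hf1 : ∀ x, f x ≤ 1 := fun x => max_le zero_le_one (min_le_left _ _)
  have hfl : ∀ x y, |f x - f y| ≤ 1 / δ * ‖x - y‖ := by
    intro x y
    have h1 : |f x - f y| ≤
        |(Metric.infDist x K - 2 * δ) / δ - (Metric.infDist y K - 2 * δ) / δ| := by
      refine (abs_max_sub_max_le_max _ _ _ _).trans (max_le (by simp) ?_)
      exact (abs_min_sub_min_le_max _ _ _ _).trans (max_le (by simp) le_rfl)
    have h2 := (Metric.lipschitz_infDist_pt K).dist_le_mul x y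
    rw [Real.dist_eq, dist_eq_norm, NNReal.coe_one, one_mul] at h2
    refine h1.trans ?_
    rw [← sub_div, sub_sub_sub_cancel_right, abs_div, abs_of_pos hδ, div_eq_mul_inv, mul_comm,
      one_div]
    gcongr
  have hfc : Continuous f := by
    have := Metric.continuous_infDist_pt K
    fun_prop
  let μ : Measure E := Measure.addHaar
  let b : ContDiffBump (0 : E) := ⟨δ / 2, δ, by positivity, by linarith⟩
  have hb0 : ∀ t, 0 ≤ b.normed μ t := b.nonneg_normed (μ := μ)
  have hbi : ∫ t, b.normed μ t ∂μ = 1 := b.integral_normed (μ := μ)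
  have hbI : Integrable (b.normed μ) μ := b.integrable_normed
  let χ : E → ℝ := convolution (b.normed μ) f (ContinuousLinearMap.lsmul ℝ ℝ) μ
  have hχ : ∀ x, χ x = ∫ t, b.normed μ t * f (x - t) ∂μ := fun x => rfl
  have hfint : ∀ x, Integrable (fun t => b.normed μ t * f (x - t)) μ := fun x =>
    ((b.contDiff_normed (n := 0)).continuous.mul (hfc.comp (continuous_const.sub
      continuous_id))).integrable_of_hasCompactSupport b.hasCompactSupport_normed.mul_right
  refine ⟨χ, ?_, fun x => ⟨?_, ?_⟩, fun x hx => ?_, fun x hx => ?_, fun x => ?_⟩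
  · have := HasCompactSupport.contDiff_convolution_left (𝕜 := ℝ) (n := 1) (μ := μ)
      (ContinuousLinearMap.lsmul ℝ ℝ) (b.hasCompactSupport_normed (μ := μ)) b.contDiff_normed
      hfc.locallyIntegrable
    exact_mod_cast this
  · rw [hχ]
    exact integral_nonneg fun t => mul_nonneg (hb0 t) (hf0 _)
  · rw [hχ, ← hbi]
    exact integral_mono (hfint x) hbI fun t => mul_le_of_le_one_right (hb0 t) (hf1 _)
  · have hz : ∀ y ∈ Metric.ball x δ, f y = 0 := fun y hy => by
      have h2 := Metric.infDist_le_infDist_add_dist (s := K) (x := y) (y := x)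
      rw [Metric.mem_ball] at hy
      refine max_eq_left (min_le_of_right_le ?_)
      exact div_nonpos_of_nonpos_of_nonneg (by linarith) hδ.le
    have hzx := hz x (Metric.mem_ball_self hδ)
    have : χ x = f x := b.normed_convolution_eq_right (μ := μ) fun y hy => by rw [hz y hy, hzx]
    rw [this, hzx]
  · have hz : ∀ y ∈ Metric.ball x δ, f y = 1 := fun y hy => by
      have h2 := Metric.infDist_le_infDist_add_dist (s := K) (x := x) (y := y)
      rw [Metric.mem_ball, dist_comm] at hy
      have : 1 ≤ (Metric.infDist y K - 2 * δ) / δ := by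
        rw [le_div_iff₀ hδ]
        linarith
      simp [f, this]
    have hzx := hz x (Metric.mem_ball_self hδ)
    have : χ x = f x := b.normed_convolution_eq_right (μ := μ) fun y hy => by rw [hz y hy, hzx]
    rw [this, hzx]
  · have hL : LipschitzWith (Real.toNNReal (1 / δ)) χ := by
      refine LipschitzWith.of_dist_le_mul fun y z => ?_
      rw [Real.coe_toNNReal _ (by positivity), Real.dist_eq, dist_eq_norm, hχ, hχ,
        ← integral_sub (hfint y) (hfint z), ← Real.norm_eq_abs]
      calc _ ≤ ∫ t, b.normed μ t * (1 / δ * ‖y - z‖) ∂μ := by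
            refine norm_integral_le_of_norm_le (hbI.mul_const _) ?_
            filter_upwards with t
            rw [← mul_sub, Real.norm_eq_abs, abs_mul, abs_of_nonneg (hb0 t)]
            refine mul_le_mul_of_nonneg_left ?_ (hb0 t)
            simpa using hfl (y - t) (z - t)
        _ = 1 / δ * ‖y - z‖ := by rw [integral_mul_const, hbi, one_mul]
    have := norm_fderiv_le_of_lipschitz ℝ hL (x₀ := x)
    rwa [Real.coe_toNNReal _ (by positivity)] at this

/-- Closed sets near which the field decays superlinearly are removable. -/
lemma weakDivNonpos_of_superlinear_decay (hF : Continuous F) {K U : Set E} {M β : ℝ} (hM : 0 ≤ M)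
    (hβ : 1 < β) (hFK : ∀ x, ‖F x‖ ≤ M * Metric.infDist x K ^ β)
    (hU : WeakDivNonpos μ F (U \ K)) : WeakDivNonpos μ F U := by
  intro ψ hψ hc hs h0
  have hdψ := hψ.continuous_fderiv one_ne_zero
  have i1 : Integrable (fun x => ‖fderiv ℝ ψ x‖) μ :=
    hdψ.norm.integrable_of_hasCompactSupport (hc.fderiv (𝕜 := ℝ)).norm
  have i2 : Integrable ψ μ := hψ.continuous.integrable_of_hasCompactSupport hc
  set A := ∫ x, ‖fderiv ℝ ψ x‖ ∂μ with hAdef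
  set B := ∫ x, ψ x ∂μ with hBdef
  have hB : 0 ≤ B := integral_nonneg h0
  have hbound : ∀ δ : ℝ, 0 < δ →
      -(M * (4 * δ) ^ β * (A + 1 / δ * B)) ≤ ∫ x, fderiv ℝ ψ x (F x) ∂μ := by
    intro δ hδ
    obtain ⟨χ, hχ, hχ01, hχ0, hχ1, hdχ⟩ := exists_contDiff_cutoff K hδ
    have h1 : ContDiff ℝ 1 fun x => ψ x * χ x := hψ.mul hχ
    have h2 : ContDiff ℝ 1 fun x => ψ x * (1 - χ x) := hψ.mul (contDiff_const.sub hχ)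
    have hsplit : ∫ x, fderiv ℝ ψ x (F x) ∂μ = ∫ x, fderiv ℝ (fun x => ψ x * χ x) x (F x) ∂μ +
        ∫ x, fderiv ℝ (fun x => ψ x * (1 - χ x)) x (F x) ∂μ := by
      rw [← integral_fderiv_apply_add h1 hc.mul_right h2 hc.mul_right hF]
      have : ψ = fun x => ψ x * χ x + ψ x * (1 - χ x) := by
        ext y
        ring
      rw [← this]
    have hpos : 0 ≤ ∫ x, fderiv ℝ (fun x => ψ x * χ x) x (F x) ∂μ := by
      refine hU _ h1 hc.mul_right (fun x hx => ⟨hs (tsupport_mul_subset_left hx), fun hxK => ?_⟩)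
        fun x => mul_nonneg (h0 x) (hχ01 x).1
      have hcl : IsClosed {x | δ ≤ Metric.infDist x K} :=
        isClosed_le continuous_const (Metric.continuous_infDist_pt K)
      have hx' : x ∈ {x | δ ≤ Metric.infDist x K} := by
        refine closure_minimal (fun y hy => ?_) hcl hx
        by_contra hlt
        exact right_ne_zero_of_mul hy (hχ0 y (not_le.1 hlt))
      rw [mem_ofPred_eq, Metric.infDist_zero_of_mem hxK] at hx'
      linarith
    have hsmall : ‖∫ x, fderiv ℝ (fun x => ψ x * (1 - χ x)) x (F x) ∂μ‖ ≤
        M * (4 * δ) ^ β * (A + 1 / δ * B) := by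
      have hi : Integrable (fun x => M * (4 * δ) ^ β * (‖fderiv ℝ ψ x‖ + 1 / δ * ψ x)) μ :=
        (i1.add (i2.const_mul _)).const_mul _
      have hval : M * (4 * δ) ^ β * (A + 1 / δ * B) =
          ∫ x, M * (4 * δ) ^ β * (‖fderiv ℝ ψ x‖ + 1 / δ * ψ x) ∂μ := by
        rw [integral_const_mul, integral_add i1 (i2.const_mul _), integral_const_mul]
      rw [hval]
      refine norm_integral_le_of_norm_le hi ?_
      filter_upwards with x
      have hψx := h0 x
      by_cases hx : 4 * δ < Metric.infDist x K
      · have : (fun x => ψ x * (1 - χ x)) =ᶠ[𝓝 x] fun _ => 0 := by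
          filter_upwards [(isOpen_lt continuous_const
            (Metric.continuous_infDist_pt K)).mem_nhds hx] with y hy
          rw [hχ1 y hy, sub_self, mul_zero]
        rw [this.fderiv_eq, fderiv_fun_const]
        simp only [Pi.zero_apply, zero_apply, norm_zero]
        positivity
      · have hFx : ‖F x‖ ≤ M * (4 * δ) ^ β := by
          refine (hFK x).trans ?_
          gcongr
          · exact Metric.infDist_nonneg
          · exact not_lt.1 hx
        refine (ContinuousLinearMap.le_opNorm _ _).trans ?_
        rw [mul_comm]
        gcongr
        have hd := ((hψ.differentiable one_ne_zero x).hasFDerivAt.mul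
          ((hχ.differentiable one_ne_zero x).hasFDerivAt.const_sub 1)).fderiv
        change ‖fderiv ℝ (ψ * fun x => 1 - χ x) x‖ ≤ _
        rw [hd]
        refine (norm_add_le _ _).trans ?_
        rw [norm_smul, norm_smul, norm_neg, Real.norm_eq_abs, Real.norm_eq_abs, abs_of_nonneg hψx,
          abs_of_nonneg (by linarith [hχ01 x] : 0 ≤ 1 - χ x), add_comm, mul_comm (1 / δ)]
        gcongr
        · exact mul_le_of_le_one_left (norm_nonneg _) (by linarith [hχ01 x])
        · exact hdχ x
    rw [hsplit]
    linarith [(abs_le.1 hsmall).1]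
  have hlim : Tendsto (fun δ : ℝ => -(M * (4 * δ) ^ β * (A + 1 / δ * B))) (𝓝[>] 0) (𝓝 0) := by
    have hev : (fun δ : ℝ => -(M * 4 ^ β * (δ ^ β * A + δ ^ (β - 1) * B))) =ᶠ[𝓝[>] 0]
        fun δ => -(M * (4 * δ) ^ β * (A + 1 / δ * B)) := by
      filter_upwards [self_mem_nhdsWithin] with δ hδ
      have hδ : 0 < δ := hδ
      rw [Real.mul_rpow (by norm_num) hδ.le, Real.rpow_sub_one hδ.ne']
      ring
    refine Tendsto.congr' hev (Tendsto.mono_left ?_ nhdsWithin_le_nhds)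
    have c1 : ContinuousAt (fun δ : ℝ => δ ^ β) 0 :=
      Real.continuousAt_rpow_const _ _ (Or.inr (by linarith))
    have c2 : ContinuousAt (fun δ : ℝ => δ ^ (β - 1)) 0 :=
      Real.continuousAt_rpow_const _ _ (Or.inr (by linarith))
    have := (((c1.mul_const A).add (c2.mul_const B)).const_mul (M * 4 ^ β)).tendsto.neg
    simpa [Real.zero_rpow (by linarith : β ≠ 0), Real.zero_rpow (by linarith : β - 1 ≠ 0)] using this
  refine le_of_tendsto hlim ?_
  filter_upwards [self_mem_nhdsWithin] with δ hδ
  exact hbound δ hδ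

omit [InnerProductSpace ℝ E] [MeasurableSpace E] [BorelSpace E] [FiniteDimensional ℝ E] in
lemma norm_le_of_iteratedFDeriv_eq_zero [NormedSpace ℝ E] (m : ℕ) {H : Type}
    [NormedAddCommGroup H] [NormedSpace ℝ H] {f : E → H} (hf : ContDiff ℝ m f) {C : ℝ}
    (hC : ∀ y, ‖iteratedFDeriv ℝ m f y‖ ≤ C) {x : E}
    (hx : ∀ k < m, iteratedFDeriv ℝ k f x = 0) (y : E) : ‖f y‖ ≤ C * ‖y - x‖ ^ m := by
  induction m generalizing H y with
  | zero => simpa using hC y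
  | succ m ih =>
    have hf' : ContDiff ℝ m (fderiv ℝ f) := hf.fderiv_right (by norm_cast)
    have hd := ih hf' (fun y => by rw [norm_iteratedFDeriv_fderiv]; exact hC y) (fun k hk => by
      rw [← norm_eq_zero, norm_iteratedFDeriv_fderiv, hx _ (by omega), norm_zero])
    have hfx : f x = 0 := by
      have := hx 0 (by omega)
      rw [← norm_eq_zero, norm_iteratedFDeriv_zero] at this
      exact norm_eq_zero.1 this
    have hC0 : 0 ≤ C := (norm_nonneg _).trans (hC x)
    have := Convex.norm_image_sub_le_of_norm_fderiv_le (𝕜 := ℝ) (f := f)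
      (C := C * ‖y - x‖ ^ m) (s := Metric.closedBall x ‖y - x‖) (x := x) (y := y)
      (fun z _ => hf.differentiable (by norm_cast) z) (fun z hz => (hd z).trans (by
        rw [Metric.mem_closedBall, dist_eq_norm] at hz
        gcongr)) (convex_closedBall _ _) (Metric.mem_closedBall_self (norm_nonneg _))
      (by rw [Metric.mem_closedBall, dist_eq_norm])
    rw [hfx, sub_zero] at this
    rw [pow_succ, ← mul_assoc]
    exact this

/-- The zero set of a smooth map dominating the field is removable: its points of finite order
lie in hypersurfaces, and near the points of high order the field decays superlinearly. -/
lemma weakDivNonpos_of_smooth_zeros {H : Type} [NormedAddCommGroup H] [NormedSpace ℝ H] {G : E → H}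
    (hG : ContDiff ℝ (⊤ : ℕ∞) G) (hGc : HasCompactSupport G) (hF : Continuous F) {C s : ℝ}
    (hC : 0 ≤ C) (hs : 0 < s) (hFG : ∀ x, ‖F x‖ ≤ C * ‖G x‖ ^ s) {U : Set E} (hU : IsOpen U)
    (h : WeakDivNonpos μ F (U ∩ {x | G x ≠ 0})) : WeakDivNonpos μ F U := by
  let K : ℕ → Set E := fun m => {x | ∀ k < m, iteratedFDeriv ℝ k G x = 0}
  have hGi : ∀ k : ℕ, ContDiff ℝ 1 (iteratedFDeriv ℝ k G) := fun k =>
    hG.iteratedFDeriv_right (m := 1) (by exact_mod_cast le_top)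
  have hK : ∀ m, IsClosed (K m) := fun m => by
    have : K m = ⋂ k, ⋂ (_ : k < m), {x | iteratedFDeriv ℝ k G x = 0} := by
      ext x
      simp [K]
    rw [this]
    exact isClosed_iInter fun k => isClosed_iInter fun _ =>
      isClosed_eq (hGi k).continuous continuous_const
  have hind : ∀ m : ℕ, WeakDivNonpos μ F (U \ K (m + 1)) := by
    intro m
    induction m with
    | zero =>
      refine h.mono fun x hx => ⟨hx.1, fun hx0 => hx.2 fun k hk => ?_⟩
      obtain rfl : k = 0 := by omega
      rw [← norm_eq_zero, norm_iteratedFDeriv_zero, hx0, norm_zero]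
    | succ m ih =>
      refine weakDivNonpos_of_locally hF fun x hx => ?_
      by_cases hxm : x ∈ K (m + 1)
      · have hne : iteratedFDeriv ℝ (m + 1) G x ≠ 0 := fun h0 => hx.2 fun k hk => by
          rcases Nat.lt_succ_iff_lt_or_eq.1 hk with hk | rfl
          · exact hxm k hk
          · exact h0
        obtain ⟨e, he⟩ : ∃ e, fderiv ℝ (iteratedFDeriv ℝ m G) x e ≠ 0 := by
          by_contra! h0
          have : ‖fderiv ℝ (iteratedFDeriv ℝ m G) x‖ ≤ 0 :=
            ContinuousLinearMap.opNorm_le_bound _ le_rfl fun e => by rw [h0 e]; simp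
          rw [norm_fderiv_iteratedFDeriv] at this
          exact hne (norm_le_zero_iff.1 this)
        obtain ⟨L, -, hL⟩ := exists_dual_vector ℝ _ (norm_ne_zero_iff.2 he)
        have hh : ContDiff ℝ 1 fun y => L (iteratedFDeriv ℝ m G y) := L.contDiff.comp (hGi m)
        have hcont : Continuous fun y => fderiv ℝ (fun y => L (iteratedFDeriv ℝ m G y)) y e :=
          (hh.continuous_fderiv one_ne_zero).clm_apply continuous_const
        have hpos : 0 < fderiv ℝ (fun y => L (iteratedFDeriv ℝ m G y)) x e := by
          have hd := (L.hasFDerivAt.comp x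
            ((hGi m).differentiable one_ne_zero x).hasFDerivAt).fderiv
          change 0 < fderiv ℝ (L ∘ iteratedFDeriv ℝ m G) x e
          rw [hd, ContinuousLinearMap.comp_apply, hL]
          simpa using he
        refine ⟨U ∩ {y | 0 < fderiv ℝ (fun y => L (iteratedFDeriv ℝ m G y)) y e},
          (hU.inter (isOpen_lt continuous_const hcont)).mem_nhds ⟨hx.1, hpos⟩,
          weakDivNonpos_of_hypersurface hF hh (fun y hy => hy.2) (ih.mono ?_)⟩
        rintro y ⟨⟨hyU, -⟩, hy⟩
        refine ⟨hyU, fun hyK => hy ?_⟩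
        rw [hyK m (Nat.lt_succ_self m), map_zero]
      · exact ⟨U \ K (m + 1), (hU.sdiff (hK _)).mem_nhds ⟨hx.1, hxm⟩, ih⟩
  obtain ⟨m, hm⟩ := exists_nat_gt (1 / s)
  rw [div_lt_iff₀ hs] at hm
  rcases (K (m + 1)).eq_empty_or_nonempty with hE | hE
  · simpa [hE] using hind m
  obtain ⟨C', hC'⟩ : ∃ C', ∀ x, ‖iteratedFDeriv ℝ (m + 1) G x‖ ≤ C' :=
    ((hGc.iteratedFDeriv (𝕜 := ℝ) (m + 1))).exists_bound_of_continuous (hGi _).continuous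
  have hC'0 : 0 ≤ C' := (norm_nonneg _).trans (hC' 0)
  refine weakDivNonpos_of_superlinear_decay hF (K := K (m + 1)) (M := C * C' ^ s)
    (β := ((m + 1 : ℕ) : ℝ) * s) (by positivity) ?_ (fun y => ?_) (hind m)
  · push_cast
    linarith
  · obtain ⟨x, hx, hxy⟩ := (hK (m + 1)).exists_infDist_eq_dist hE y
    have hb := norm_le_of_iteratedFDeriv_eq_zero (m + 1) (hG.of_le (by exact_mod_cast le_top)) hC' hx y
    rw [hxy, dist_eq_norm]
    calc ‖F y‖ ≤ C * ‖G y‖ ^ s := hFG y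
      _ ≤ C * (C' * ‖y - x‖ ^ (m + 1)) ^ s := by gcongr
      _ = C * C' ^ s * ‖y - x‖ ^ (((m + 1 : ℕ) : ℝ) * s) := by
        rw [Real.mul_rpow hC'0 (by positivity), Real.rpow_mul (norm_nonneg _), Real.rpow_natCast,
          mul_assoc]

omit [MeasurableSpace E] [BorelSpace E] in
lemma exists_contDiff_hasCompactSupport_eqOn {f : E → ℝ} {K U : Set E} (hK : IsCompact K)
    (hU : IsOpen U) (hKU : K ⊆ U) (hf : ContDiffOn ℝ (⊤ : ℕ∞) f U) :
    ∃ (g : E → ℝ) (W : Set E), ContDiff ℝ (⊤ : ℕ∞) g ∧ HasCompactSupport g ∧ IsOpen W ∧ K ⊆ W ∧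
      W ⊆ U ∧ EqOn g f W := by
  obtain ⟨L, hL, hKL, hLU⟩ := exists_compact_between hK hU hKU
  obtain ⟨χ, hχ1, hχ0, -⟩ := exists_contMDiffMap_one_nhds_of_subset_interior
    (n := (⊤ : ℕ∞)) (modelWithCornersSelf ℝ E) hK.isClosed hKL
  obtain ⟨W, hW, hKW, hW1⟩ := mem_nhdsSet_iff_exists.1 hχ1
  have hsupp : tsupport χ ⊆ L := closure_minimal (fun x hx => by
    by_contra hxL
    exact hx (hχ0 x hxL)) hL.isClosed
  have hχc : HasCompactSupport χ := hL.of_isClosed_subset (isClosed_tsupport _) hsupp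
  refine ⟨fun x => χ x * f x, W ∩ interior L, ?_, hχc.mul_right, hW.inter isOpen_interior,
    subset_inter hKW hKL, inter_subset_right.trans (interior_subset.trans hLU), fun x hx => ?_⟩
  · refine contDiff_iff_contDiffAt.2 fun x => ?_
    by_cases hx : x ∈ tsupport χ
    · exact χ.contMDiff.contDiff.contDiffAt.mul (hf.contDiffAt (hU.mem_nhds (hLU (hsupp hx))))
    · refine (contDiffAt_const (c := (0 : ℝ))).congr_of_eventuallyEq ?_
      filter_upwards [notMem_tsupport_iff_eventuallyEq.1 hx] with y hy
      simp [hy]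
  · have : χ x = 1 := hW1 hx.1
    simp [this]

lemma rpow_sub_two_mul_self {t p : ℝ} (ht : 0 ≤ t) (hp : 1 < p) : t ^ (p - 2) * t = t ^ (p - 1) := by
  rcases ht.eq_or_lt with rfl | ht
  · rw [mul_zero, Real.zero_rpow (by linarith)]
  · rw [← Real.rpow_add_one ht.ne']
    ring_nf

lemma rpow_sub_one_mul_self {t p : ℝ} (ht : 0 ≤ t) (hp : 1 < p) : t ^ (p - 1) * t = t ^ p := by
  rcases ht.eq_or_lt with rfl | ht
  · rw [mul_zero, Real.zero_rpow (by linarith)]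
  · rw [← Real.rpow_add_one ht.ne']
    ring_nf

omit [InnerProductSpace ℝ E] [MeasurableSpace E] [BorelSpace E] [FiniteDimensional ℝ E] in
lemma norm_rpow_sub_two_smul [NormedSpace ℝ E] {p : ℝ} (hp : 1 < p) (z : E) :
    ‖‖z‖ ^ (p - 2) • z‖ = ‖z‖ ^ (p - 1) := by
  rw [norm_smul, Real.norm_of_nonneg (by positivity), rpow_sub_two_mul_self (norm_nonneg z) hp]

omit [InnerProductSpace ℝ E] [MeasurableSpace E] [BorelSpace E] [FiniteDimensional ℝ E] in
lemma continuous_norm_rpow_sub_two_smul [NormedSpace ℝ E] {p : ℝ} (hp : 1 < p) :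
    Continuous fun z : E => ‖z‖ ^ (p - 2) • z := by
  refine continuous_iff_continuousAt.2 fun z => ?_
  rcases eq_or_ne z 0 with rfl | hz
  · have h : ContinuousAt (fun z : E => ‖z‖ ^ (p - 1)) 0 :=
      continuous_norm.continuousAt.rpow_const (Or.inr (by linarith))
    rw [ContinuousAt, norm_zero, Real.zero_rpow (by linarith)] at h
    rw [ContinuousAt, smul_zero]
    refine tendsto_zero_iff_norm_tendsto_zero.2 (h.congr fun z => ?_)
    rw [norm_rpow_sub_two_smul hp]
  · exact (continuous_norm.continuousAt.rpow_const (Or.inl (norm_ne_zero_iff.2 hz))).smul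
      continuousAt_id

lemma weakDivNonpos_pLaplacian {g : E → ℝ} (hg : ContDiff ℝ (⊤ : ℕ∞) g) (hgc : HasCompactSupport g)
    {p c : ℝ} (hp : 1 < p) {W : Set E} (hW : IsOpen W)
    (h : ∀ x ∈ W, gradient g x ≠ 0 → c * LinearMap.trace ℝ E
      (fderiv ℝ (fun y => ‖gradient g y‖ ^ (p - 2) • gradient g y) x : E →ₗ[ℝ] E) ≤ 0) :
    Continuous (fun x => c • ‖gradient g x‖ ^ (p - 2) • gradient g x) ∧
      WeakDivNonpos μ (fun x => c • ‖gradient g x‖ ^ (p - 2) • gradient g x) W := by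
  have hG : ContDiff ℝ (⊤ : ℕ∞) (gradient g) :=
    (InnerProductSpace.toDual ℝ E).symm.contDiff.comp (hg.fderiv_right (by simp))
  have hGc : HasCompactSupport (gradient g) :=
    (hgc.fderiv (𝕜 := ℝ)).comp_left (map_zero (InnerProductSpace.toDual ℝ E).symm)
  have hF : Continuous fun x => c • ‖gradient g x‖ ^ (p - 2) • gradient g x :=
    ((continuous_norm_rpow_sub_two_smul hp).comp hG.continuous).const_smul c
  refine ⟨hF, weakDivNonpos_of_smooth_zeros hG hGc hF (abs_nonneg c) (sub_pos.2 hp)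
    (fun x => by rw [norm_smul, norm_rpow_sub_two_smul hp, Real.norm_eq_abs]) hW ?_⟩
  intro φ hφ hc hs h0
  have hV : ∀ x ∈ tsupport φ,
      ContDiffAt ℝ 1 (fun y => ‖gradient g y‖ ^ (p - 2) • gradient g y) x := fun x hx => by
    have hGx : ContDiffAt ℝ 1 (gradient g) x := (hG.of_le (by norm_cast)).contDiffAt
    exact ((hGx.norm ℝ (hs hx).2).rpow_const_of_ne (norm_ne_zero_iff.2 (hs hx).2)).smul hGx
  rw [(integral_fderiv_apply_eq_neg_integral_trace hφ hc hF
    fun x hx => contDiffAt_const.smul (hV x hx)).2, ← integral_neg]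
  refine integral_nonneg fun x => ?_
  by_cases hx : x ∈ tsupport φ
  · have := h x (hs hx).1 (hs hx).2
    rw [fderiv_fun_const_smul ((hV x hx).differentiableAt one_ne_zero)]
    simp only [ContinuousLinearMap.toLinearMap_smul, map_smul, smul_eq_mul, Pi.zero_apply]
    exact neg_nonneg.2 (mul_nonpos_of_nonneg_of_nonpos (h0 x) this)
  · simp [image_eq_zero_of_notMem_tsupport hx]

lemma hardy_young {p α d g t r : ℝ} (hp : 1 < p) (hα : p - 1 - α ≠ 0) (hd : 0 ≤ d) (hg : 0 ≤ g)
    (ht : 0 ≤ t) (hr : 0 < r) :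
    |p - 1 - α| * (p * r ^ (-(p - 1 - α)) * (t ^ (p - 1) * d * g ^ (p - 1))) -
        (p - 1 - α) ^ 2 * (r ^ (-(p - 1 - α) - 1) * t ^ p * g ^ p) ≤
      p * (|p - 1 - α| / p) ^ (2 - p) *
        (r ^ α * d ^ p - (|p - 1 - α| / p) ^ p * (g ^ p / r ^ (p - α) * t ^ p)) := by
  have hp0 : 0 < p := by linarith
  set k := |p - 1 - α| / p with hk
  have hk0 : 0 < k := by positivity
  have hck : |p - 1 - α| = p * k := by rw [hk]; field_simp
  have hc2 : (p - 1 - α) ^ 2 = p ^ 2 * k ^ 2 := by rw [← sq_abs, hck]; ring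
  have hyoung : ∀ a y : ℝ, 0 ≤ a → 0 ≤ y → p * (a * y ^ (p - 1)) ≤ a ^ p + (p - 1) * y ^ p := by
    intro a y ha hy
    have := Real.geom_mean_le_arith_mean2_weighted (w₁ := 1 / p) (w₂ := (p - 1) / p)
      (p₁ := a ^ p) (p₂ := y ^ p) (by positivity) (div_nonneg (by linarith) hp0.le)
      (by positivity) (by positivity) (by field_simp; ring)
    rw [← Real.rpow_mul ha, ← Real.rpow_mul hy, mul_one_div_cancel hp0.ne', Real.rpow_one,
      mul_div_cancel₀ _ hp0.ne'] at this
    calc p * (a * y ^ (p - 1)) ≤ p * (1 / p * a ^ p + (p - 1) / p * y ^ p) := by gcongr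
      _ = a ^ p + (p - 1) * y ^ p := by field_simp
  have h := hyoung (d * r ^ (α / p)) (k * g * t * r ^ ((α - p) / p)) (by positivity)
    (by positivity)
  have e1 : (d * r ^ (α / p)) ^ p = r ^ α * d ^ p := by
    rw [Real.mul_rpow hd (by positivity), ← Real.rpow_mul hr.le, div_mul_cancel₀ _ hp0.ne', mul_comm]
  have e2 : (k * g * t * r ^ ((α - p) / p)) ^ p = k ^ p * (g ^ p * t ^ p * r ^ (α - p)) := by
    rw [Real.mul_rpow (by positivity) (by positivity), Real.mul_rpow (by positivity) ht,
      Real.mul_rpow hk0.le hg, ← Real.rpow_mul hr.le, div_mul_cancel₀ _ hp0.ne']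
    ring
  have e3 : d * r ^ (α / p) * (k * g * t * r ^ ((α - p) / p)) ^ (p - 1) =
      k ^ (p - 1) * (t ^ (p - 1) * d * g ^ (p - 1) * r ^ (-(p - 1 - α))) := by
    have : r ^ (-(p - 1 - α)) = r ^ (α / p) * r ^ ((α - p) / p * (p - 1)) := by
      rw [← Real.rpow_add hr]
      congr 1
      field_simp
      ring
    rw [Real.mul_rpow (by positivity) (by positivity), Real.mul_rpow (by positivity) ht,
      Real.mul_rpow hk0.le hg, ← Real.rpow_mul hr.le, this]
    ring
  have e4 : g ^ p / r ^ (p - α) * t ^ p = g ^ p * t ^ p * r ^ (α - p) := by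
    rw [← neg_sub p α, Real.rpow_neg hr.le]
    ring
  have k1 : k ^ (2 - p) * k ^ (p - 1) = k := by
    rw [← Real.rpow_add hk0, show 2 - p + (p - 1) = 1 by ring, Real.rpow_one]
  have k2 : k ^ (2 - p) * k ^ p = k ^ 2 := by
    rw [← Real.rpow_add hk0, show 2 - p + p = ((2 : ℕ) : ℝ) by norm_num, Real.rpow_natCast]
  rw [e1, e2, e3] at h
  rw [e4, hc2, hck, show -(p - 1 - α) - 1 = α - p by ring]
  set A := t ^ (p - 1) * d * g ^ (p - 1) * r ^ (-(p - 1 - α))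
  set Y := g ^ p * t ^ p * r ^ (α - p)
  have h' := mul_le_mul_of_nonneg_left h (by positivity : 0 ≤ p * k ^ (2 - p))
  calc _ = p * k ^ (2 - p) * (p * (k ^ (p - 1) * A)) - p ^ 2 * k ^ 2 * Y := by
        linear_combination (-p ^ 2 * A) * k1
    _ ≤ p * k ^ (2 - p) * (r ^ α * d ^ p + (p - 1) * (k ^ p * Y)) - p ^ 2 * k ^ 2 * Y := by
        gcongr
    _ = _ := by linear_combination (p ^ 2 * Y) * k2

omit [MeasurableSpace E] [BorelSpace E] in
lemma hardy_fderiv_apply_le {p α : ℝ} (hp : 1 < p) (hα : p - 1 - α ≠ 0) {u ρ : E → ℝ} {x : E}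
    (hu : DifferentiableAt ℝ u x) (hρ : DifferentiableAt ℝ ρ x) (hpos : 0 < ρ x) :
    fderiv ℝ (fun y => ‖u y‖ ^ p * ρ y ^ (-(p - 1 - α))) x
        ((p - 1 - α) • ‖gradient ρ x‖ ^ (p - 2) • gradient ρ x) ≤
      p * (|p - 1 - α| / p) ^ (2 - p) * (ρ x ^ α * ‖fderiv ℝ u x‖ ^ p -
        (|p - 1 - α| / p) ^ p * (‖gradient ρ x‖ ^ p / ρ x ^ (p - α) * |u x| ^ p)) := by
  refine le_trans (?_ : _ ≤ (p - 1 - α) * (p * ρ x ^ (-(p - 1 - α)) * (|u x| ^ (p - 2) * u x *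
      fderiv ℝ u x (‖gradient ρ x‖ ^ (p - 2) • gradient ρ x))) -
    (p - 1 - α) ^ 2 * (ρ x ^ (-(p - 1 - α) - 1) * |u x| ^ p * ‖gradient ρ x‖ ^ p))
    (le_trans (sub_le_sub_right ?_ _) (hardy_young hp hα (norm_nonneg (fderiv ℝ u x))
      (norm_nonneg (gradient ρ x)) (abs_nonneg (u x)) hpos))
  · have h1 := ((hasFDerivAt_norm_rpow (u x) hp).comp x hu.hasFDerivAt).mul
      (hρ.hasFDerivAt.rpow_const (p := -(p - 1 - α)) (Or.inl hpos.ne'))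
    have h2 : fderiv ℝ ρ x (gradient ρ x) = ‖gradient ρ x‖ ^ 2 := by
      rw [← inner_gradient_left, real_inner_self_eq_norm_sq]
    have h3 : ‖gradient ρ x‖ ^ (p - 2) * ‖gradient ρ x‖ ^ 2 = ‖gradient ρ x‖ ^ p := by
      rw [sq, ← mul_assoc, rpow_sub_two_mul_self (norm_nonneg _) hp,
        rpow_sub_one_mul_self (norm_nonneg _) hp]
    have h4 := h1.fderiv
    change fderiv ℝ (fun y => ‖u y‖ ^ p * ρ y ^ (-(p - 1 - α))) x = _ at h4
    rw [h4]
    simp [h2]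
    rw [← h3]
    exact le_of_eq (by ring)
  · refine (le_abs_self _).trans ?_
    rw [abs_mul]
    gcongr
    rw [abs_mul, abs_of_nonneg (by positivity)]
    gcongr
    rw [abs_mul, abs_mul, abs_of_nonneg (by positivity : 0 ≤ |u x| ^ (p - 2)),
      rpow_sub_two_mul_self (abs_nonneg _) hp, mul_assoc, ← norm_rpow_sub_two_smul hp (gradient ρ x)]
    gcongr
    exact (fderiv ℝ u x).le_opNorm _

end WeakDivergence

/-- Weighted Hardy inequality for p-sub/superharmonic functions (Euclidean setting). -/
theorem stmt_17 (n : ℕ) (p α : ℝ) (hp : 1 < p) (hα : p - 1 - α ≠ 0)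
    (Ω : Set (EuclideanSpace ℝ (Fin n))) (hΩ : IsOpen Ω)
    (ρ : EuclideanSpace ℝ (Fin n) → ℝ)
    (hρ : ContDiffOn ℝ (⊤ : ℕ∞) ρ Ω) (hρpos : ∀ x ∈ Ω, 0 < ρ x)
    (V : EuclideanSpace ℝ (Fin n) → EuclideanSpace ℝ (Fin n))
    (hV : ∀ x, V x = ‖gradient ρ x‖ ^ (p - 2) • gradient ρ x)
    (hsub : ∀ x ∈ Ω, 0 ≤ (p - 1 - α) * (-(vdiv17 V x)))
    (hloc : p < α →
      LocallyIntegrableOn (fun x => ‖gradient ρ x‖ ^ p / ρ x ^ (p - α)) Ω volume ∧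
      LocallyIntegrableOn (fun x => ρ x ^ α) Ω volume) :
    ∀ u : EuclideanSpace ℝ (Fin n) → ℝ,
      ContDiff ℝ (⊤ : ℕ∞) u → HasCompactSupport u → tsupport u ⊆ Ω →
        ∫ x in Ω, ρ x ^ α * ‖fderiv ℝ u x‖ ^ p
          ≥ (|p - 1 - α| / p) ^ p *
            ∫ x in Ω, (‖gradient ρ x‖ ^ p / ρ x ^ (p - α)) * |u x| ^ p := by
  intro u hu huc huΩ
  have hSc : IsCompact (tsupport u) := huc
  have hp0 : 0 < p := by linarith
  obtain ⟨g, W, hg, hgc, hW, hSW, hWΩ, hgρ⟩ :=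
    exists_contDiff_hasCompactSupport_eqOn hSc hΩ huΩ hρ
  have hgrad : ∀ x ∈ W, gradient g x = gradient ρ x := fun x hx =>
    (hgρ.eventuallyEq_of_mem (hW.mem_nhds hx)).gradient_eq
  have hρat : ∀ x ∈ Ω, ContDiffAt ℝ (⊤ : ℕ∞) ρ x := fun x hx => hρ.contDiffAt (hΩ.mem_nhds hx)
  obtain ⟨hF, hweak⟩ := weakDivNonpos_pLaplacian (μ := volume) (c := p - 1 - α) hg hgc hp hW
    fun x hx _ => by
      have : (fun y => ‖gradient g y‖ ^ (p - 2) • gradient g y) =ᶠ[nhds x] V := by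
        filter_upwards [hW.mem_nhds hx] with y hy
        rw [hV, hgrad y hy]
      rw [this.fderiv_eq]
      have := hsub x (hWΩ hx)
      rw [vdiv17] at this
      linarith
  let φ : EuclideanSpace ℝ (Fin n) → ℝ := fun y => ‖u y‖ ^ p * ρ y ^ (-(p - 1 - α))
  let I : EuclideanSpace ℝ (Fin n) → ℝ :=
    fun x => (‖gradient ρ x‖ ^ p / ρ x ^ (p - α)) * |u x| ^ p
  let J : EuclideanSpace ℝ (Fin n) → ℝ := fun x => ρ x ^ α * ‖fderiv ℝ u x‖ ^ p
  have hφ0 : ∀ x, x ∉ tsupport u → φ x = 0 := fun x hx => by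
    simp [φ, image_eq_zero_of_notMem_tsupport hx, Real.zero_rpow hp0.ne']
  have hI0 : ∀ x, x ∉ tsupport u → I x = 0 := fun x hx => by
    simp [I, image_eq_zero_of_notMem_tsupport hx, Real.zero_rpow hp0.ne']
  have hJ0 : ∀ x, x ∉ tsupport u → J x = 0 := fun x hx => by
    simp [J, fderiv_of_notMem_tsupport ℝ hx, Real.zero_rpow hp0.ne']
  have hts : ∀ f : EuclideanSpace ℝ (Fin n) → ℝ, (∀ x, x ∉ tsupport u → f x = 0) →
      tsupport f ⊆ tsupport u := fun f hf => closure_minimal (fun x hx => by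
        by_contra hxu
        exact hx (hf x hxu)) (isClosed_tsupport u)
  have hcpt : ∀ f : EuclideanSpace ℝ (Fin n) → ℝ, (∀ x, x ∉ tsupport u → f x = 0) →
      HasCompactSupport f := fun f hf => hSc.of_isClosed_subset (isClosed_tsupport f) (hts f hf)
  have hfint : ∀ f : EuclideanSpace ℝ (Fin n) → ℝ, (∀ x, x ∉ tsupport u → f x = 0) →
      (∀ x ∈ Ω, ContinuousAt f x) → Integrable f := fun f hf hc =>
    (continuous_of_tsupport fun x hx => hc x (huΩ (hts f hf hx))).integrable_of_hasCompactSupport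
      (hcpt f hf)
  have hφ : ContDiff ℝ 1 φ := contDiff_iff_contDiffAt.2 fun x => by
    by_cases hx : x ∈ tsupport u
    · exact ((contDiff_norm_rpow hp).comp (hu.of_le (by norm_cast))).contDiffAt.mul
        (((hρat x (huΩ hx)).of_le (by norm_cast)).rpow_const_of_ne (hρpos x (huΩ hx)).ne')
    · refine (contDiffAt_const (c := (0 : ℝ))).congr_of_eventuallyEq ?_
      filter_upwards [(isClosed_tsupport u).isOpen_compl.mem_nhds hx] with y hy using hφ0 y hy
  have hIint : Integrable I := hfint I hI0 fun x hx => by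
    have hgradx : ContinuousAt (gradient ρ) x :=
      (InnerProductSpace.toDual ℝ (EuclideanSpace ℝ (Fin n))).symm.continuous.continuousAt.comp
        ((hρat x hx).continuousAt_fderiv (by simp))
    exact ((hgradx.norm.rpow_const (Or.inr hp0.le)).div
      ((hρat x hx).continuousAt.rpow_const (Or.inl (hρpos x hx).ne'))
      (Real.rpow_pos_of_pos (hρpos x hx) _).ne').mul
      (hu.continuous.abs.continuousAt.rpow_const (Or.inr hp0.le))
  have hJint : Integrable J := hfint J hJ0 fun x hx =>
    ((hρat x hx).continuousAt.rpow_const (Or.inl (hρpos x hx).ne')).mul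
      ((hu.continuous_fderiv (by simp)).norm.continuousAt.rpow_const (Or.inr hp0.le))
  have hkey := hweak φ hφ (hcpt φ hφ0) ((hts φ hφ0).trans hSW) fun x => by
    by_cases hx : x ∈ tsupport u
    · exact mul_nonneg (by positivity) (Real.rpow_nonneg (hρpos x (huΩ hx)).le _)
    · exact (hφ0 x hx).ge
  set k := |p - 1 - α| / p with hk
  have hk0 : 0 < k := div_pos (abs_pos.2 hα) hp0
  have hle := integral_mono (integrable_fderiv_apply hφ (hcpt φ hφ0) hF)
    ((hJint.sub (hIint.const_mul (k ^ p))).const_mul (p * k ^ (2 - p))) fun x => by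
      by_cases hx : x ∈ tsupport u
      · have := hardy_fderiv_apply_le hp hα (hu.differentiable (by simp) x)
          ((hρat x (huΩ hx)).differentiableAt (by simp)) (hρpos x (huΩ hx))
        rw [← hgrad x (hSW hx)] at this
        simpa [φ, I, J, hgrad x (hSW hx)] using this
      · simp [hI0 x hx, hJ0 x hx, fderiv_of_notMem_tsupport ℝ (fun h => hx (hts φ hφ0 h))]
  rw [integral_const_mul, integral_sub' hJint (hIint.const_mul _), integral_const_mul] at hle
  have hfin := nonneg_of_mul_nonneg_right (hkey.trans hle) (by positivity)
  change ∫ x in Ω, J x ≥ k ^ p * ∫ x in Ω, I x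
  rw [setIntegral_eq_integral_of_forall_compl_eq_zero fun x hx => hJ0 x fun h => hx (huΩ h),
    setIntegral_eq_integral_of_forall_compl_eq_zero fun x hx => hI0 x fun h => hx (huΩ h)]
  linarith
end
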